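/- arXiv:2305.04363 — 3 statements merged into one kernel-verified Lean document; each statement's English description precedes it below -/
import Mathlib

section
/- There exist constants τ' > 0 and c > 0 such that for every ε ∈ (0,1) and all sufficiently large n: (i) for every k with log₂ n ≤ k ≤ 2^{(log n)^{1−ε}}, every distribution X on {0,1}^n sampled with decision depth at most τ'·(log n)^ε satisfies Δ(X, U_k^n) ≥ 1 − n^{−ck}; (ii) for every k with 1 ≤ k < log₂ n, every distribution X on {0,1}^n sampled with decision depth at most τ'·(log n)^ε / log log n satisfies Δ(X, U_k^n) ≥ 1 − n^{−ck}. -/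
open Finset

/-- Hamming weight of a bit string. -/
def wt {n : ℕ} (x : Fin n → Bool) : ℕ := (Finset.univ.filter fun i => x i = true).card

/-- Binary decision trees querying input bits. -/
inductive DTree (m : ℕ) : Type
  | leaf : Bool → DTree m
  | node : Fin m → DTree m → DTree m → DTree m

def DTree.eval {m : ℕ} : DTree m → (Fin m → Bool) → Bool
  | .leaf b, _ => b
  | .node i t0 t1, y => if y i then t1.eval y else t0.eval y

def DTree.depth {m : ℕ} : DTree m → ℕ
  | .leaf _ => 0
  | .node _ t0 t1 => max t0.depth t1.depth + 1

/-- `f` has decision depth `d`: every output bit is computed by a depth-`≤ d` decision tree. -/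
def hasDecisionDepth {m n : ℕ} (f : (Fin m → Bool) → (Fin n → Bool)) (d : ℕ) : Prop :=
  ∀ j : Fin n, ∃ t : DTree m, t.depth ≤ d ∧ ∀ y, f y j = t.eval y

/-- The mass function of the distribution `f(Y)` for `Y` uniform on `{0,1}^m`. -/
noncomputable def srcDist {m n : ℕ} (f : (Fin m → Bool) → (Fin n → Bool)) :
    (Fin n → Bool) → ℝ :=
  fun x => ((Finset.univ.filter fun y => f y = x).card : ℝ) / 2 ^ m

/-- The mass function of the uniform distribution on Hamming-weight-`k` strings. -/
noncomputable def uniformSlice (n k : ℕ) : (Fin n → Bool) → ℝ :=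
  fun x => if wt x = k then 1 / (n.choose k : ℝ) else 0

/-- Statistical distance between two mass functions: `max_A |P(A) - Q(A)|`. -/
noncomputable def SD {α : Type*} [Fintype α] (P Q : α → ℝ) : ℝ :=
  ⨆ A : Finset α, |∑ x ∈ A, P x - ∑ x ∈ A, Q x|

/-- The partial assignment `t` is satisfied by `y`. -/
def Sat {m : ℕ} (y : Fin m → Bool) (t : Finset (Fin m × Bool)) : Prop :=
  ∀ l ∈ t, y l.1 = l.2

instance {m : ℕ} (y : Fin m → Bool) (t : Finset (Fin m × Bool)) : Decidable (Sat y t) := by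
  unfold Sat; infer_instance

/-- The set of literals read by the tree on input `y`. -/
def DTree.path {m : ℕ} : DTree m → (Fin m → Bool) → Finset (Fin m × Bool)
  | .leaf _, _ => ∅
  | .node i t0 t1, y => insert (i, y i) (if y i then t1.path y else t0.path y)

theorem DTree.path_card {m : ℕ} (t : DTree m) (y : Fin m → Bool) :
    (t.path y).card ≤ t.depth := by
  induction t with
  | leaf b => simp [DTree.path]
  | node i t0 t1 h0 h1 =>
    simp only [DTree.path, DTree.depth]
    refine (Finset.card_insert_le _ _).trans ?_
    split_ifs <;> omega

theorem DTree.sat_path {m : ℕ} (t : DTree m) (y : Fin m → Bool) : Sat y (t.path y) := by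
  induction t with
  | leaf b => simp [DTree.path, Sat]
  | node i t0 t1 h0 h1 =>
    intro l hl
    simp only [DTree.path, Finset.mem_insert] at hl
    rcases hl with rfl | hl
    · rfl
    · split_ifs at hl
      · exact h1 l hl
      · exact h0 l hl

theorem DTree.path_unique {m : ℕ} (t : DTree m) (y z : Fin m → Bool) (h : Sat z (t.path y)) :
    t.path z = t.path y ∧ t.eval z = t.eval y := by
  induction t with
  | leaf b => simp [DTree.path, DTree.eval]
  | node i t0 t1 h0 h1 =>
    have hi : z i = y i := h (i, y i) (by simp [DTree.path])
    have hr : Sat z (if y i then t1.path y else t0.path y) := by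
      intro l hl
      exact h l (by simp only [DTree.path, Finset.mem_insert]; exact Or.inr hl)
    simp only [DTree.path, DTree.eval, hi]
    split_ifs with hy
    · rw [if_pos hy] at hr
      obtain ⟨a, b⟩ := h1 hr
      exact ⟨by rw [a], b⟩
    · rw [if_neg hy] at hr
      obtain ⟨a, b⟩ := h0 hr
      exact ⟨by rw [a], b⟩

theorem DTree.path_count {m : ℕ} (t : DTree m) :
    (Finset.univ.image t.path).card ≤ 2 ^ t.depth := by
  classical
  induction t with
  | leaf b =>
    refine (Finset.card_le_card (t := {∅}) ?_).trans (by simp [DTree.depth])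
    intro s hs
    simp only [Finset.mem_image, DTree.path] at hs
    obtain ⟨_, _, rfl⟩ := hs
    simp
  | node i t0 t1 h0 h1 =>
    have hsub : Finset.univ.image (DTree.node i t0 t1).path ⊆
        ((Finset.univ.image t0.path).image (insert (i, false))) ∪
        ((Finset.univ.image t1.path).image (insert (i, true))) := by
      intro s hs
      simp only [Finset.mem_image, DTree.path] at hs
      obtain ⟨y, _, rfl⟩ := hs
      simp only [Finset.mem_union, Finset.mem_image, Finset.mem_univ, true_and]
      cases hy : y i
      · left; exact ⟨_, ⟨y, rfl⟩, by simp⟩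
      · right; exact ⟨_, ⟨y, rfl⟩, by simp⟩
    refine (Finset.card_le_card hsub).trans ((Finset.card_union_le _ _).trans ?_)
    have a0 := (Finset.card_image_le (s := Finset.univ.image t0.path) (f := insert (i, false))).trans h0
    have a1 := (Finset.card_image_le (s := Finset.univ.image t1.path) (f := insert (i, true))).trans h1
    have e0 : 2 ^ t0.depth ≤ 2 ^ (max t0.depth t1.depth) :=
      Nat.pow_le_pow_right (by norm_num) (le_max_left _ _)
    have e1 : 2 ^ t1.depth ≤ 2 ^ (max t0.depth t1.depth) :=
      Nat.pow_le_pow_right (by norm_num) (le_max_right _ _)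
    simp only [DTree.depth, pow_succ]
    omega

/-- Counting assignments that agree with a partial assignment. -/
theorem card_agree {m : ℕ} {β : Type*} [Fintype β] [DecidableEq β] (v : Bool → β)
    (hv : Function.Injective v)
    (t : Finset (Fin m × Bool)) :
    ((Finset.univ.filter fun w : Fin m → β => ∀ l ∈ t, w l.1 = v l.2).card : ℝ)
      * (Fintype.card β : ℝ) ^ t.card ≤ (Fintype.card β : ℝ) ^ m ∧
    ((∃ y, Sat y t) →
    ((Finset.univ.filter fun w : Fin m → β => ∀ l ∈ t, w l.1 = v l.2).card : ℝ)
      * (Fintype.card β : ℝ) ^ t.card = (Fintype.card β : ℝ) ^ m) := by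
  classical
  have key : (∃ y, Sat y t) →
    ((Finset.univ.filter fun w : Fin m → β => ∀ l ∈ t, w l.1 = v l.2).card : ℝ)
      * (Fintype.card β : ℝ) ^ t.card = (Fintype.card β : ℝ) ^ m := by
    rintro ⟨y, hy⟩
    have hinj : Set.InjOn Prod.fst (t : Set (Fin m × Bool)) := by
      intro a ha b hb hab
      have h1 := hy a ha
      have h2 := hy b hb
      rw [hab] at h1
      exact Prod.ext hab (h1.symm.trans h2)
    have hset : (Finset.univ.filter fun w : Fin m → β => ∀ l ∈ t, w l.1 = v l.2) =
        Fintype.piFinset (fun i => if i ∈ t.image Prod.fst then {v (y i)} else Finset.univ) := by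
      ext w
      simp only [Finset.mem_filter, Finset.mem_univ, true_and, Fintype.mem_piFinset]
      constructor
      · intro h i
        split_ifs with hi
        · obtain ⟨l, hl, rfl⟩ := Finset.mem_image.1 hi
          rw [Finset.mem_singleton, h l hl, hy l hl]
        · simp
      · intro h l hl
        have := h l.1
        rw [if_pos (Finset.mem_image_of_mem _ hl), Finset.mem_singleton] at this
        rw [this, hy l hl]
    rw [hset, Fintype.card_piFinset, ← Finset.card_image_of_injOn hinj]
    have : ∀ i, (if i ∈ t.image Prod.fst then {v (y i)} else (Finset.univ : Finset β)).card =
      if i ∈ t.image Prod.fst then 1 else Fintype.card β := by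
      intro i; split_ifs <;> simp
    simp only [this]
    rw [Finset.prod_ite]
    simp only [Finset.prod_const_one, one_mul, Finset.prod_const]
    push_cast
    rw [← pow_add]
    congr 1
    have := Finset.card_filter_add_card_filter_not (s := (Finset.univ : Finset (Fin m))) (fun i => i ∈ t.image Prod.fst)
    simp only [Finset.filter_univ_mem, Finset.card_univ, Fintype.card_fin] at this
    omega
  refine ⟨?_, key⟩
  by_cases h : ∃ y, Sat y t
  · exact (key h).le
  · have : (Finset.univ.filter fun w : Fin m → β => ∀ l ∈ t, w l.1 = v l.2) = ∅ := by
      rw [Finset.filter_eq_empty_iff]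
      intro w _ hw
      apply h
      refine ⟨fun i => decide (w i = v true), fun l hl => ?_⟩
      show decide (w l.1 = v true) = l.2
      rw [hw l hl]
      have := hv.eq_iff (a := l.2) (b := true)
      simp [this]
    rw [this]; simp

theorem one_add_pow_small (x : ℝ) (d e : ℕ) (hx : 0 ≤ x) (he : e ≤ d) (h : x * (d + 1) ≤ 1 / 128) :
    (1 + x) ^ e ≤ 1 + 1 / 64 := by
  have h1 : (1 + x) ^ e ≤ (1 + x) ^ d := pow_le_pow_right₀ (by linarith) he
  have h2 : (1 + x) ^ d ≤ Real.exp (d * x) := by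
    rw [Real.exp_nat_mul]
    exact pow_le_pow_left₀ (by linarith) (by linarith [Real.add_one_le_exp x]) _
  have h3 : (d : ℝ) * x ≤ 1 / 128 := by nlinarith
  have h4 : Real.exp (d * x) ≤ Real.exp (1 / 128) := Real.exp_le_exp.2 h3
  have h5 : Real.exp (1 / 128 : ℝ) ≤ 1 + 1 / 64 := by
    have := Real.exp_bound_div_one_sub_of_interval (x := 1 / 128) (by norm_num) (by norm_num)
    exact this.trans (by norm_num)
  linarith

theorem pair_sum {m d : ℕ} {ι : Type*} (G : Finset ι)
    (lk : ι → Finset (Fin m × Bool)) (M R : ℝ) (hM : 0 ≤ M) (hR0 : 0 < R)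
    (hd : ∀ g ∈ G, (lk g).card ≤ d)
    (hs : ∀ W : Finset (Fin m × Bool), W.Nonempty →
      ((G.filter fun g => W ⊆ lk g).card : ℝ) * R ^ W.card ≤ 2 * G.card)
    (hR : M / R * (d + 1) ≤ 1 / 128) (g : ι) (hg : g ∈ G) :
    ∑ g' ∈ G, M ^ (lk g ∩ lk g').card ≤ G.card * (1 + 1 / 32) := by
  classical
  have h1 : ∀ g' ∈ G, M ^ (lk g ∩ lk g').card ≤
      1 + ∑ W ∈ (lk g).powerset.erase ∅, if W ⊆ lk g' then M ^ W.card else 0 := by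
    intro g' _
    have hnn : ∀ W ∈ (lk g).powerset.erase ∅, 0 ≤ if W ⊆ lk g' then M ^ W.card else 0 := by
      intro W _; split_ifs <;> positivity
    by_cases h : lk g ∩ lk g' = ∅
    · rw [h]
      have := Finset.sum_nonneg hnn
      simp only [Finset.card_empty, pow_zero]
      linarith
    · have := Finset.single_le_sum hnn (a := lk g ∩ lk g')
        (by simp only [Finset.mem_erase, Finset.mem_powerset]; exact ⟨h, Finset.inter_subset_left⟩)
      rw [if_pos Finset.inter_subset_right] at this
      linarith
  refine (Finset.sum_le_sum h1).trans ?_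
  rw [Finset.sum_add_distrib, Finset.sum_comm]
  have h2 : ∀ W ∈ (lk g).powerset.erase ∅,
      ∑ g' ∈ G, (if W ⊆ lk g' then M ^ W.card else 0) ≤ 2 * G.card * (M / R) ^ W.card := by
    intro W hW
    have hne : W.Nonempty := Finset.nonempty_iff_ne_empty.2 (Finset.mem_erase.1 hW).1
    rw [← Finset.sum_filter, Finset.sum_const, nsmul_eq_mul, div_pow]
    have h3 := hs W hne
    have : ((G.filter fun g => W ⊆ lk g).card : ℝ) ≤ 2 * G.card / R ^ W.card := by
      rw [le_div_iff₀ (by positivity)]; exact h3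
    calc ((G.filter fun g => W ⊆ lk g).card : ℝ) * M ^ W.card
        ≤ 2 * G.card / R ^ W.card * M ^ W.card := by gcongr
      _ = _ := by ring
  have h4 := Finset.sum_le_sum h2
  rw [← Finset.mul_sum] at h4
  have h5 : ∑ W ∈ (lk g).powerset, (M / R) ^ W.card = (1 + M / R) ^ (lk g).card := by
    have := Finset.prod_one_add (lk g) (f := fun _ => M / R)
    simp only [Finset.prod_const] at this
    exact this.symm
  have h6 := Finset.add_sum_erase (lk g).powerset (fun W => (M / R) ^ W.card)
    (Finset.empty_mem_powerset _)
  simp only [Finset.card_empty, pow_zero] at h6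
  have h7 := one_add_pow_small (M / R) d _ (by positivity) (hd g hg) hR
  have h8 : ∑ W ∈ (lk g).powerset.erase ∅, (M / R) ^ W.card ≤ 1 / 64 := by linarith
  have h9 : 2 * (G.card : ℝ) * ∑ W ∈ (lk g).powerset.erase ∅, (M / R) ^ W.card
      ≤ 2 * (G.card : ℝ) * (1 / 64) := by gcongr
  simp only [Finset.sum_const, nsmul_eq_mul, mul_one]
  linarith

theorem second_moment {m L d : ℕ} {ι : Type*} (G : Finset ι)
    (lk : ι → Finset (Fin m × Bool)) (R : ℝ) (hG : G.Nonempty)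
    (hd : ∀ g ∈ G, (lk g).card ≤ d)
    (hc : ∀ g ∈ G, ∃ y, Sat y (lk g))
    (hs : ∀ W : Finset (Fin m × Bool), W.Nonempty →
      ((G.filter fun g => W ⊆ lk g).card : ℝ) * R ^ W.card ≤ 2 * G.card)
    (hL : 0 < L) (hR : 256 * (L : ℝ) * (d + 1) ≤ R) (b : Fin L) :
    ((Finset.univ.filter fun w : Fin m → Fin L × Bool =>
      ∀ g ∈ G, ¬ ∀ l ∈ lk g, w l.1 = (b, l.2)).card : ℝ) * 32 ≤ ((L : ℝ) * 2) ^ m := by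
  classical
  set M : ℝ := (L : ℝ) * 2 with hMdef
  have hLr : (0 : ℝ) < L := by exact_mod_cast hL
  have hM : 0 < M := by positivity
  have hR0 : 0 < R := lt_of_lt_of_le (by positivity) hR
  have hcard : (Fintype.card (Fin L × Bool) : ℝ) = M := by simp [hMdef]
  have hv : Function.Injective (fun a : Bool => (b, a)) := fun a a' h => (Prod.mk.inj h).2
  let I : ι → (Fin m → Fin L × Bool) → ℝ := fun g w =>
    if ∀ l ∈ lk g, w l.1 = (b, l.2) then 1 else 0
  let X : (Fin m → Fin L × Bool) → ℝ := fun w => ∑ g ∈ G, M ^ (lk g).card * I g w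
  have hI1 : ∀ g ∈ G, M ^ (lk g).card * ∑ w, I g w = M ^ m := by
    intro g hg
    have := (card_agree (fun a : Bool => (b, a)) hv (lk g)).2 (hc g hg)
    rw [hcard] at this
    simp only [I, Finset.sum_boole]
    rw [mul_comm]; exact this
  have hI2 : ∀ g g', M ^ (lk g).card * M ^ (lk g').card * ∑ w, I g w * I g' w
      ≤ M ^ m * M ^ (lk g ∩ lk g').card := by
    intro g g'
    have := (card_agree (fun a : Bool => (b, a)) hv (lk g ∪ lk g')).1
    rw [hcard] at this
    have e : ∑ w, I g w * I g' w = ((Finset.univ.filter fun w : Fin m → Fin L × Bool =>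
        ∀ l ∈ lk g ∪ lk g', w l.1 = (b, l.2)).card : ℝ) := by
      rw [← Finset.sum_boole]
      refine Finset.sum_congr rfl fun w _ => ?_
      have : (∀ l ∈ lk g ∪ lk g', w l.1 = (b, l.2)) ↔
        (∀ l ∈ lk g, w l.1 = (b, l.2)) ∧ (∀ l ∈ lk g', w l.1 = (b, l.2)) := by
        simp only [Finset.mem_union]
        constructor
        · intro h; exact ⟨fun l hl => h l (Or.inl hl), fun l hl => h l (Or.inr hl)⟩
        · rintro ⟨h1, h2⟩ l (hl | hl)
          · exact h1 l hl
          · exact h2 l hl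
      simp only [I, this]
      split_ifs <;> simp_all
    rw [e, ← pow_add, ← Finset.card_union_add_card_inter, pow_add]
    calc _ = (((Finset.univ.filter fun w : Fin m → Fin L × Bool =>
        ∀ l ∈ lk g ∪ lk g', w l.1 = (b, l.2)).card : ℝ) * M ^ (lk g ∪ lk g').card)
          * M ^ (lk g ∩ lk g').card := by ring
      _ ≤ _ := by gcongr
  have hX1 : ∑ w, X w = G.card * M ^ m := by
    simp only [X]
    rw [Finset.sum_comm]
    simp only [← Finset.mul_sum]
    rw [Finset.sum_congr rfl hI1]; simp
  have hX2 : ∑ w, X w ^ 2 ≤ M ^ m * (G.card * (G.card * (1 + 1 / 32))) := by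
    have e : ∑ w, X w ^ 2 = ∑ g ∈ G, ∑ g' ∈ G,
        M ^ (lk g).card * M ^ (lk g').card * ∑ w, I g w * I g' w := by
      simp only [X, sq, Finset.sum_mul_sum]
      simp only [Finset.mul_sum]
      rw [Finset.sum_comm]
      refine Finset.sum_congr rfl fun g _ => ?_
      rw [Finset.sum_comm]
      refine Finset.sum_congr rfl fun g' _ => ?_
      refine Finset.sum_congr rfl fun w _ => ?_
      ring
    rw [e]
    calc _ ≤ ∑ g ∈ G, ∑ g' ∈ G, M ^ m * M ^ (lk g ∩ lk g').card :=
          Finset.sum_le_sum fun g _ => Finset.sum_le_sum fun g' _ => hI2 g g'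
      _ = M ^ m * ∑ g ∈ G, ∑ g' ∈ G, M ^ (lk g ∩ lk g').card := by
          simp only [Finset.mul_sum]
      _ ≤ M ^ m * ∑ g ∈ G, (G.card * (1 + 1 / 32) : ℝ) := by
          refine mul_le_mul_of_nonneg_left ?_ (by positivity)
          refine Finset.sum_le_sum fun g hg => ?_
          refine pair_sum (d := d) G lk M R hM.le hR0 hd hs ?_ g hg
          rw [div_mul_eq_mul_div, div_le_iff₀ hR0]
          rw [hMdef]; linarith
      _ = _ := by simp
  have hcheb : ((Finset.univ.filter fun w : Fin m → Fin L × Bool =>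
      ∀ g ∈ G, ¬ ∀ l ∈ lk g, w l.1 = (b, l.2)).card : ℝ) * (G.card : ℝ) ^ 2
      ≤ ∑ w, (X w - G.card) ^ 2 := by
    rw [← nsmul_eq_mul, ← Finset.sum_const]
    calc _ ≤ ∑ w ∈ (Finset.univ.filter fun w : Fin m → Fin L × Bool =>
      ∀ g ∈ G, ¬ ∀ l ∈ lk g, w l.1 = (b, l.2)), (X w - G.card) ^ 2 := by
          refine Finset.sum_le_sum fun w hw => ?_
          have hw := (Finset.mem_filter.1 hw).2
          have : X w = 0 := Finset.sum_eq_zero fun g hg => by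
            simp only [I]; rw [if_neg (hw g hg), mul_zero]
          rw [this]; simp
      _ ≤ _ := Finset.sum_le_sum_of_subset_of_nonneg (Finset.filter_subset _ _)
          fun _ _ _ => sq_nonneg _
  have hexp : ∑ w, (X w - G.card) ^ 2 = ∑ w, X w ^ 2 - 2 * G.card * ∑ w, X w
      + M ^ m * (G.card : ℝ) ^ 2 := by
    have hN : ((Finset.univ : Finset (Fin m → Fin L × Bool)).card : ℝ) = M ^ m := by
      rw [Finset.card_univ, Fintype.card_fun, Fintype.card_fin]; push_cast; rw [hcard]
    rw [← hN, ← nsmul_eq_mul (Finset.card _), ← Finset.sum_const, Finset.mul_sum,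
      ← Finset.sum_sub_distrib, ← Finset.sum_add_distrib]
    refine Finset.sum_congr rfl fun w _ => ?_
    ring
  have hg0 : (0 : ℝ) < G.card := by exact_mod_cast hG.card_pos
  rw [hX1] at hexp
  have hfin : ((Finset.univ.filter fun w : Fin m → Fin L × Bool =>
      ∀ g ∈ G, ¬ ∀ l ∈ lk g, w l.1 = (b, l.2)).card : ℝ) * 32 * (G.card : ℝ) ^ 2
      ≤ M ^ m * (G.card : ℝ) ^ 2 := by nlinarith
  exact le_of_mul_le_mul_right hfin (by positivity)

/-- Independence over colour classes. -/
theorem indep_prod {m L : ℕ} (c : Fin m → Fin L) (h : Fin L → (Fin m → Bool) → ℝ)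
    (hh : ∀ b y z, (∀ i, c i = b → y i = z i) → h b y = h b z) :
    (∑ y : Fin m → Bool, ∏ b, h b y) * ((2 : ℝ) ^ m) ^ L
      = (2 : ℝ) ^ m * ∏ b, ∑ y : Fin m → Bool, h b y := by
  classical
  have e1 : ∏ b, ∑ y : Fin m → Bool, h b y =
      ∑ Y : Fin L → Fin m → Bool, ∏ b, h b (fun i => Y (c i) i) := by
    rw [Finset.prod_univ_sum]
    rw [Fintype.piFinset_univ]
    refine Finset.sum_congr rfl fun Y _ => Finset.prod_congr rfl fun b _ => ?_
    exact hh _ _ _ fun i hi => by rw [hi]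
  rw [e1]
  set F : (Fin m → Bool) → ℝ := fun y => ∏ b, h b y with hF
  have e2 : ∀ z : Fin m → Bool, ∑ Y : Fin L → Fin m → Bool, F (fun i => Y (c i) i)
      = ∑ Y : Fin L → Fin m → Bool, F (fun i => xor (z i) (Y (c i) i)) := by
    intro z
    have hinv : Function.Involutive (fun (Y : Fin L → Fin m → Bool) b i => xor (z i) (Y b i)) := by
      intro Y; funext b i; simp
    exact (Equiv.sum_comp hinv.toPerm (fun Y : Fin L → Fin m → Bool => F (fun i => Y (c i) i))).symm
  have e3 : ∀ x : Fin m → Bool, ∑ z : Fin m → Bool, F (fun i => xor (z i) (x i)) = ∑ y, F y := by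
    intro x
    have hinv : Function.Involutive (fun (z : Fin m → Bool) i => xor (z i) (x i)) := by
      intro Y; funext i; simp
    exact Equiv.sum_comp hinv.toPerm F
  have e4 : ∑ z : Fin m → Bool, ∑ Y : Fin L → Fin m → Bool, F (fun i => Y (c i) i)
      = ∑ Y : Fin L → Fin m → Bool, ∑ y, F y := by
    rw [Finset.sum_congr rfl fun z _ => e2 z, Finset.sum_comm]
    exact Finset.sum_congr rfl fun Y _ => e3 _
  simp only [Finset.sum_const, Finset.card_univ, Fintype.card_fun, Fintype.card_fin,
    Fintype.card_bool, nsmul_eq_mul] at e4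
  push_cast at e4
  rw [mul_comm, ← e4]

theorem exists_colouring {m L d : ℕ} {ι : Type*} (G : Finset ι)
    (lk : ι → Finset (Fin m × Bool)) (R : ℝ) (hG : G.Nonempty)
    (hd : ∀ g ∈ G, (lk g).card ≤ d)
    (hc : ∀ g ∈ G, ∃ y, Sat y (lk g))
    (hs : ∀ W : Finset (Fin m × Bool), W.Nonempty →
      ((G.filter fun g => W ⊆ lk g).card : ℝ) * R ^ W.card ≤ 2 * G.card)
    (hL : 0 < L) (hR : 256 * (L : ℝ) * (d + 1) ≤ R) :
    ∃ c : Fin m → Fin L, ∑ b : Fin L, ((Finset.univ.filter fun y : Fin m → Bool =>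
      ∀ g ∈ G, ¬ ∀ l ∈ lk g, c l.1 = b ∧ y l.1 = l.2).card : ℝ) ≤ L * 2 ^ m / 32 := by
  classical
  have : Nonempty (Fin L) := ⟨⟨0, hL⟩⟩
  have hsum : ∀ b : Fin L, ∑ c : Fin m → Fin L, ((Finset.univ.filter fun y : Fin m → Bool =>
      ∀ g ∈ G, ¬ ∀ l ∈ lk g, c l.1 = b ∧ y l.1 = l.2).card : ℝ) =
      ((Finset.univ.filter fun w : Fin m → Fin L × Bool =>
      ∀ g ∈ G, ¬ ∀ l ∈ lk g, w l.1 = (b, l.2)).card : ℝ) := by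
    intro b
    simp only [← Finset.sum_boole]
    rw [← Fintype.sum_prod_type']
    refine (Equiv.sum_comp (Equiv.arrowProdEquivProdArrow (Fin m) (fun _ => Fin L) (fun _ => Bool)) _).symm.trans ?_
    refine Finset.sum_congr rfl fun w _ => ?_
    simp [Equiv.arrowProdEquivProdArrow, Prod.ext_iff]
  have htot : ∑ c : Fin m → Fin L, ∑ b : Fin L, ((Finset.univ.filter fun y : Fin m → Bool =>
      ∀ g ∈ G, ¬ ∀ l ∈ lk g, c l.1 = b ∧ y l.1 = l.2).card : ℝ)
      ≤ ∑ c : Fin m → Fin L, ((L : ℝ) * 2 ^ m / 32) := by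
    rw [Finset.sum_comm]
    simp only [hsum]
    calc _ ≤ ∑ b : Fin L, ((L : ℝ) * 2) ^ m / 32 := by
          refine Finset.sum_le_sum fun b _ => ?_
          have := second_moment G lk R hG hd hc hs hL hR b
          linarith
      _ = _ := by
          simp only [Finset.sum_const, Finset.card_univ, Fintype.card_fun, Fintype.card_fin,
            nsmul_eq_mul, mul_pow]
          push_cast
          ring
  obtain ⟨c, _, h⟩ := Finset.exists_le_of_sum_le Finset.univ_nonempty htot
  exact ⟨c, h⟩

theorem spread_lemma {m L d : ℕ} {ι : Type*} (G : Finset ι)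
    (lk : ι → Finset (Fin m × Bool)) (R : ℝ) (hG : G.Nonempty)
    (hd : ∀ g ∈ G, (lk g).card ≤ d)
    (hc : ∀ g ∈ G, ∃ y, Sat y (lk g))
    (hs : ∀ W : Finset (Fin m × Bool), W.Nonempty →
      ((G.filter fun g => W ⊆ lk g).card : ℝ) * R ^ W.card ≤ 2 * G.card)
    (hL : 0 < L) (hR : 256 * (L : ℝ) * (d + 1) ≤ R) (k : ℕ) (hk : 2 * k ≤ L) :
    ∃ c : Fin m → Fin L, ((Finset.univ.filter fun y : Fin m → Bool =>
      (Finset.univ.filter fun b : Fin L => ∃ g ∈ G, ∀ l ∈ lk g, c l.1 = b ∧ y l.1 = l.2).card ≤ k).card : ℝ)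
      * 2 ^ L ≤ 2 ^ m := by
  classical
  obtain ⟨c, hcol⟩ := exists_colouring G lk R hG hd hc hs hL hR
  refine ⟨c, ?_⟩
  let E : Fin L → (Fin m → Bool) → Prop := fun b y =>
    ∀ g ∈ G, ¬ ∀ l ∈ lk g, c l.1 = b ∧ y l.1 = l.2
  let h : Fin L → (Fin m → Bool) → ℝ := fun b y => if E b y then 16 else 1
  have hdep : ∀ b y z, (∀ i, c i = b → y i = z i) → h b y = h b z := by
    intro b y z hyz
    have : E b y ↔ E b z := by
      refine forall₂_congr fun g _ => not_congr (forall₂_congr fun l _ => ?_)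
      constructor
      · rintro ⟨h1, h2⟩; exact ⟨h1, by rw [← hyz _ h1]; exact h2⟩
      · rintro ⟨h1, h2⟩; exact ⟨h1, by rw [hyz _ h1]; exact h2⟩
    simp only [h, this]
  have hind := indep_prod c h hdep
  have hone : ∀ b y, 1 ≤ h b y := by
    intro b y; simp only [h]; split_ifs <;> norm_num
  have hsumb : ∀ b, ∑ y : Fin m → Bool, h b y =
      2 ^ m * (1 + 15 * ((Finset.univ.filter fun y => E b y).card : ℝ) / 2 ^ m) := by
    intro b
    have : ∀ y, h b y = 1 + 15 * (if E b y then 1 else 0) := by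
      intro y; simp only [h]; split_ifs <;> norm_num
    simp only [this, Finset.sum_add_distrib, ← Finset.mul_sum]
    simp
    field_simp
    simp [Finset.card_filter]
  have hprod : ∏ b, ∑ y : Fin m → Bool, h b y ≤ ((2 : ℝ) ^ m) ^ L * 2 ^ L := by
    simp only [hsumb]
    rw [Finset.prod_mul_distrib]
    simp only [Finset.prod_const, Finset.card_univ, Fintype.card_fin]
    refine mul_le_mul_of_nonneg_left ?_ (by positivity)
    calc ∏ b : Fin L, (1 + 15 * ((Finset.univ.filter fun y => E b y).card : ℝ) / 2 ^ m)
        ≤ ∏ b : Fin L, Real.exp (15 * ((Finset.univ.filter fun y => E b y).card : ℝ) / 2 ^ m) := by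
          refine Finset.prod_le_prod (fun b _ => by positivity) fun b _ => ?_
          rw [add_comm]; exact Real.add_one_le_exp _
      _ = Real.exp (15 * (∑ b : Fin L, ((Finset.univ.filter fun y => E b y).card : ℝ)) / 2 ^ m) := by
          rw [← Real.exp_sum, Finset.mul_sum, Finset.sum_div]
      _ ≤ Real.exp (L * Real.log 2) := by
          apply Real.exp_le_exp.2
          rw [div_le_iff₀ (by positivity)]
          have hl2 := Real.log_two_gt_d9
          have : (L : ℝ) * 2 ^ m * (15 / 32) ≤ (L : ℝ) * 2 ^ m * Real.log 2 := by
            apply mul_le_mul_of_nonneg_left _ (by positivity); linarith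
          have h' : ∑ b : Fin L, ((Finset.univ.filter fun y => E b y).card : ℝ) ≤ L * 2 ^ m / 32 := hcol
          linarith
      _ = 2 ^ L := by rw [Real.exp_nat_mul, Real.exp_log (by norm_num)]
  have hlow : ((Finset.univ.filter fun y : Fin m → Bool =>
      (Finset.univ.filter fun b : Fin L => ∃ g ∈ G, ∀ l ∈ lk g, c l.1 = b ∧ y l.1 = l.2).card ≤ k).card : ℝ)
      * 4 ^ L ≤ ∑ y : Fin m → Bool, ∏ b, h b y := by
    rw [← nsmul_eq_mul, ← Finset.sum_const]
    refine le_trans (Finset.sum_le_sum fun y hy => ?_)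
      (Finset.sum_le_sum_of_subset_of_nonneg (Finset.filter_subset _ _)
        fun y _ _ => Finset.prod_nonneg fun b _ => zero_le_one.trans (hone b y))
    have hy := (Finset.mem_filter.1 hy).2
    have hE : (Finset.univ.filter fun b : Fin L => ∃ g ∈ G, ∀ l ∈ lk g, c l.1 = b ∧ y l.1 = l.2) =
      Finset.univ.filter fun b : Fin L => ¬ E b y := by
      ext b; simp [E]
    rw [hE] at hy
    have hadd := Finset.card_filter_add_card_filter_not (s := (Finset.univ : Finset (Fin L))) (fun b => E b y)
    simp only [Finset.card_univ, Fintype.card_fin] at hadd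
    have : ∏ b, h b y = 16 ^ (Finset.univ.filter fun b : Fin L => E b y).card := by
      simp only [h]; rw [Finset.prod_ite]; simp
    rw [this, show (16 : ℝ) = 4 ^ 2 by norm_num, ← pow_mul]
    exact pow_le_pow_right₀ (by norm_num) (by omega)
  have hS : (∑ y : Fin m → Bool, ∏ b, h b y) ≤ 2 ^ m * 2 ^ L := by
    have hpos : (0 : ℝ) < ((2 : ℝ) ^ m) ^ L := by positivity
    refine le_of_mul_le_mul_right ?_ hpos
    rw [hind]
    calc _ ≤ (2 : ℝ) ^ m * (((2 : ℝ) ^ m) ^ L * 2 ^ L) :=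
          mul_le_mul_of_nonneg_left hprod (by positivity)
      _ = _ := by ring
  have h4 : (4 : ℝ) ^ L = 2 ^ L * 2 ^ L := by rw [← mul_pow]; norm_num
  rw [h4, ← mul_assoc] at hlow
  exact le_of_mul_le_mul_right (hlow.trans hS) (by positivity)

/-- The set of pairs (output, accepting path). -/
noncomputable def terms {m n : ℕ} (T : Fin n → DTree m) :
    Finset (Fin n × Finset (Fin m × Bool)) :=
  open Classical in
  Finset.univ.filter fun p => ∃ y, (T p.1).eval y = true ∧ (T p.1).path y = p.2

theorem terms_sat {m n : ℕ} (T : Fin n → DTree m) {p} (hp : p ∈ terms T) {y : Fin m → Bool}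
    (hy : Sat y p.2) : (T p.1).eval y = true ∧ (T p.1).path y = p.2 := by
  classical
  obtain ⟨z, h1, h2⟩ := (Finset.mem_filter.1 hp).2
  rw [← h2] at hy ⊢
  obtain ⟨a, b⟩ := (T p.1).path_unique z y hy
  exact ⟨b.trans h1, a⟩

theorem terms_card {m n d : ℕ} (T : Fin n → DTree m) (hT : ∀ j, (T j).depth ≤ d) :
    (terms T).card ≤ n * 2 ^ d := by
  classical
  have : terms T ⊆ (Finset.univ : Finset (Fin n)).biUnion
      fun j => (Finset.univ.image (T j).path).image (fun t => (j, t)) := by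
    intro p hp
    obtain ⟨z, h1, h2⟩ := (Finset.mem_filter.1 hp).2
    simp only [Finset.mem_biUnion, Finset.mem_image, Finset.mem_univ, true_and]
    exact ⟨p.1, p.2, ⟨z, h2⟩, rfl⟩
  refine (Finset.card_le_card this).trans (Finset.card_biUnion_le.trans ?_)
  calc _ ≤ ∑ j : Fin n, 2 ^ d := Finset.sum_le_sum fun j _ =>
        Finset.card_image_le.trans ((T j).path_count.trans (Nat.pow_le_pow_right (by norm_num) (hT j)))
    _ = _ := by simp

theorem exists_kernel {m n d k L : ℕ} (T : Fin n → DTree m) (hT : ∀ j, (T j).depth ≤ d)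
    (F : Finset (Fin n × Finset (Fin m × Bool))) (hF : F ⊆ terms T) (R : ℝ)
    (hk : 1 ≤ k) (hL : 2 * k ≤ L) (hR : 256 * (L : ℝ) * (d + 1) ≤ R)
    (hcard : 2 * (k : ℝ) * R ^ d ≤ F.card) :
    ∃ Z, (∃ p ∈ F, Z ⊆ p.2) ∧
      ((Finset.univ.filter fun y : Fin m → Bool =>
        Sat y Z ∧ (Finset.univ.filter fun j => (T j).eval y = true).card ≤ k).card : ℝ) * 2 ^ L
        ≤ 2 ^ m := by
  classical
  have hk' : (1 : ℝ) ≤ k := by exact_mod_cast hk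
  have hL' : (1 : ℝ) ≤ L := by exact_mod_cast (by omega : 1 ≤ L)
  have hR1 : (1 : ℝ) ≤ R := by
    refine le_trans ?_ hR
    have : (0 : ℝ) ≤ d := by positivity
    nlinarith
  let FZ : Finset (Fin m × Bool) → Finset (Fin n × Finset (Fin m × Bool)) :=
    fun Z => F.filter fun p => Z ⊆ p.2
  obtain ⟨Z, -, hZ⟩ := Finset.exists_max_image (Finset.univ : Finset (Finset (Fin m × Bool)))
    (fun Z => ((FZ Z).card : ℝ) * R ^ Z.card) Finset.univ_nonempty
  have hZ0 := hZ ∅ (Finset.mem_univ _)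
  have hF0 : FZ ∅ = F := by simp [FZ]
  simp only [hF0, Finset.card_empty, pow_zero, mul_one] at hZ0
  have hpos : 0 < ((FZ Z).card : ℝ) * R ^ Z.card := by
    have : 0 < 2 * (k : ℝ) * R ^ d := by positivity
    linarith
  have hne : (FZ Z).Nonempty := by
    rw [← Finset.card_pos]
    by_contra h0
    simp [Nat.eq_zero_of_not_pos h0] at hpos
  have hcd : ∀ p ∈ F, p.2.card ≤ d := by
    intro p hp
    obtain ⟨z, -, h2⟩ := (Finset.mem_filter.1 (hF hp)).2
    rw [← h2]; exact ((T p.1).path_card z).trans (hT _)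
  have hZd : Z.card ≤ d := by
    obtain ⟨p, hp⟩ := hne
    exact (Finset.card_le_card (Finset.mem_filter.1 hp).2).trans (hcd p (Finset.mem_filter.1 hp).1)
  have hbig : 2 * k ≤ (FZ Z).card := by
    have h1 : R ^ Z.card ≤ R ^ d := pow_le_pow_right₀ hR1 hZd
    have h2 : 2 * (k : ℝ) * R ^ Z.card ≤ ((FZ Z).card : ℝ) * R ^ Z.card := by
      have : 2 * (k : ℝ) * R ^ Z.card ≤ 2 * (k : ℝ) * R ^ d := by gcongr
      linarith
    have h3 := le_of_mul_le_mul_right h2 (by positivity)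
    exact_mod_cast h3
  refine ⟨Z, ?_, ?_⟩
  · obtain ⟨p, hp⟩ := hne
    exact ⟨p, (Finset.mem_filter.1 hp).1, (Finset.mem_filter.1 hp).2⟩
  by_cases hE : k < ((FZ Z).filter fun p => p.2 = Z).card
  · have : (Finset.univ.filter fun y : Fin m → Bool =>
        Sat y Z ∧ (Finset.univ.filter fun j => (T j).eval y = true).card ≤ k) = ∅ := by
      rw [Finset.filter_eq_empty_iff]
      rintro y - ⟨hy, hw⟩
      refine absurd (lt_of_lt_of_le hE ?_) (not_lt.2 hw)
      refine Finset.card_le_card_of_injOn Prod.fst ?_ ?_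
      · intro p hp
        simp only [Finset.coe_filter, Set.mem_ofPred_eq] at hp
        simp only [Finset.coe_filter, Set.mem_ofPred_eq, Finset.mem_univ, true_and]
        have hpF := hF (Finset.mem_filter.1 hp.1).1
        exact (terms_sat T hpF (by rw [hp.2]; exact hy)).1
      · intro p hp q hq hpq
        simp only [Finset.coe_filter, Set.mem_ofPred_eq] at hp hq
        exact Prod.ext hpq (hp.2.trans hq.2.symm)
    rw [this]; simp
  · push Not at hE
    set G := (FZ Z).filter fun p => ¬ p.2 = Z with hGdef
    have hadd := Finset.card_filter_add_card_filter_not (s := FZ Z) (fun p => p.2 = Z)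
    rw [← hGdef] at hadd
    have hGk : k ≤ G.card := by omega
    have hG2 : (FZ Z).card ≤ 2 * G.card := by omega
    have hG2' : ((FZ Z).card : ℝ) ≤ 2 * G.card := by exact_mod_cast hG2
    have hGF : ∀ g ∈ G, g ∈ F ∧ Z ⊆ g.2 ∧ g.2 ≠ Z := by
      intro g hg
      obtain ⟨h1, h2⟩ := Finset.mem_filter.1 hg
      exact ⟨(Finset.mem_filter.1 h1).1, (Finset.mem_filter.1 h1).2, h2⟩
    obtain ⟨c, hc⟩ := spread_lemma (d := d) (L := L) G (fun p => p.2 \ Z) R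
      (Finset.card_pos.1 (by omega))
      (fun g hg => (Finset.card_le_card Finset.sdiff_subset).trans (hcd g (hGF g hg).1))
      (fun g hg => by
        obtain ⟨z, h1, h2⟩ := (Finset.mem_filter.1 (hF (hGF g hg).1)).2
        refine ⟨z, fun l hl => ?_⟩
        have := (T g.1).sat_path z
        rw [h2] at this
        exact this l (Finset.sdiff_subset hl))
      (fun W hW => by
        by_cases hdis : Disjoint Z W
        · have hm := hZ (Z ∪ W) (Finset.mem_univ _)
          rw [Finset.card_union_of_disjoint hdis, pow_add, mul_comm (R ^ Z.card), ← mul_assoc] at hm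
          have hm' := le_of_mul_le_mul_right hm (by positivity)
          refine le_trans ?_ (hm'.trans hG2')
          refine mul_le_mul_of_nonneg_right ?_ (by positivity)
          norm_cast
          refine Finset.card_le_card fun g hg => ?_
          obtain ⟨h1, h2⟩ := Finset.mem_filter.1 hg
          refine Finset.mem_filter.2 ⟨(hGF g h1).1, Finset.union_subset (hGF g h1).2.1
            (h2.trans Finset.sdiff_subset)⟩
        · have : (G.filter fun g => W ⊆ g.2 \ Z) = ∅ := by
            rw [Finset.filter_eq_empty_iff]
            intro g _ hsub
            exact hdis (Finset.disjoint_of_subset_right hsub Finset.disjoint_sdiff)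
          rw [this]; simp)
      (by omega) hR k hL
    refine le_trans (mul_le_mul_of_nonneg_right ?_ (by positivity)) hc
    norm_cast
    refine Finset.card_le_card fun y hy => ?_
    obtain ⟨-, hyZ, hw⟩ := Finset.mem_filter.1 hy
    refine Finset.mem_filter.2 ⟨Finset.mem_univ _, le_trans ?_ hw⟩
    have hex : ∀ b : Fin L, b ∈ (Finset.univ.filter fun b : Fin L =>
        ∃ g ∈ G, ∀ l ∈ g.2 \ Z, c l.1 = b ∧ y l.1 = l.2) →
        ∃ g ∈ G, ∀ l ∈ g.2 \ Z, c l.1 = b ∧ y l.1 = l.2 := fun b hb => (Finset.mem_filter.1 hb).2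
    have hGne : G.Nonempty := Finset.card_pos.1 (by omega)
    have hex' : ∀ b : Fin L, ∃ g, b ∈ (Finset.univ.filter fun b : Fin L =>
        ∃ g ∈ G, ∀ l ∈ g.2 \ Z, c l.1 = b ∧ y l.1 = l.2) →
        g ∈ G ∧ ∀ l ∈ g.2 \ Z, c l.1 = b ∧ y l.1 = l.2 := by
      intro b
      by_cases hb : b ∈ (Finset.univ.filter fun b : Fin L =>
        ∃ g ∈ G, ∀ l ∈ g.2 \ Z, c l.1 = b ∧ y l.1 = l.2)
      · obtain ⟨g, h1, h2⟩ := hex b hb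
        exact ⟨g, fun _ => ⟨h1, h2⟩⟩
      · exact ⟨hGne.choose, fun h => absurd h hb⟩
    choose φ hφ using hex'
    have hsat : ∀ b ∈ (Finset.univ.filter fun b : Fin L =>
        ∃ g ∈ G, ∀ l ∈ g.2 \ Z, c l.1 = b ∧ y l.1 = l.2),
        (T (φ b).1).eval y = true ∧ (T (φ b).1).path y = (φ b).2 := by
      intro b hb
      obtain ⟨h1, h2⟩ := hφ b hb
      refine terms_sat T (hF (hGF _ h1).1) fun l hl => ?_
      by_cases hlZ : l ∈ Z
      · exact hyZ l hlZ
      · exact (h2 l (Finset.mem_sdiff.2 ⟨hl, hlZ⟩)).2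
    refine Finset.card_le_card_of_injOn (fun b => (φ b).1) ?_ ?_
    · intro b hb
      exact Finset.mem_coe.2 (Finset.mem_filter.2 ⟨Finset.mem_univ _, (hsat b hb).1⟩)
    · intro b hb b' hb' hbb
      have hbb : (φ b).1 = (φ b').1 := hbb
      have e : (φ b).2 = (φ b').2 := by
        rw [← (hsat b hb).2, ← (hsat b' hb').2, hbb]
      obtain ⟨h1, h2⟩ := hφ b hb
      obtain ⟨h1', h2'⟩ := hφ b' hb'
      have hnel : ((φ b).2 \ Z).Nonempty := by
        rw [Finset.sdiff_nonempty]
        intro hsub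
        exact (hGF _ h1).2.2 (Finset.Subset.antisymm hsub (hGF _ h1).2.1)
      obtain ⟨l, hl⟩ := hnel
      rw [← (h2 l hl).1, ← (h2' l (by rw [← e]; exact hl)).1]

theorem choose_ratio (a n k : ℕ) (h : a ≤ n) : a.choose k * n ^ k ≤ n.choose k * a ^ k := by
  have key : ∀ k, a.descFactorial k * n ^ k ≤ n.descFactorial k * a ^ k := by
    intro k
    induction k with
    | zero => simp
    | succ k ih =>
      rw [Nat.descFactorial_succ, Nat.descFactorial_succ, pow_succ, pow_succ]
      have h1 : (a - k) * n ≤ (n - k) * a := by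
        rcases le_total a k with hk | hk
        · rw [Nat.sub_eq_zero_of_le hk]; simp
        · obtain ⟨u, rfl⟩ := Nat.exists_eq_add_of_le hk
          obtain ⟨v, rfl⟩ := Nat.exists_eq_add_of_le h
          have e1 : k + u - k = u := by omega
          have e2 : k + u + v - k = u + v := by omega
          rw [e1, e2]
          nlinarith
      calc (a - k) * a.descFactorial k * (n ^ k * n)
          = ((a - k) * n) * (a.descFactorial k * n ^ k) := by ring
        _ ≤ ((n - k) * a) * (n.descFactorial k * a ^ k) := Nat.mul_le_mul h1 ih
        _ = _ := by ring
  have := key k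
  rw [Nat.descFactorial_eq_factorial_mul_choose, Nat.descFactorial_eq_factorial_mul_choose,
    mul_assoc, mul_assoc] at this
  exact Nat.le_of_mul_le_mul_left this (Nat.factorial_pos k)

theorem card_slice {n : ℕ} (k : ℕ) (J : Finset (Fin n)) :
    (Finset.univ.filter fun x : Fin n → Bool => wt x = k ∧
      (Finset.univ.filter fun i => x i = true) ⊆ J).card = J.card.choose k := by
  classical
  rw [← Finset.card_powersetCard]
  refine Finset.card_bij (fun x _ => Finset.univ.filter fun i => x i = true) ?_ ?_ ?_
  · intro x hx
    obtain ⟨-, h1, h2⟩ := Finset.mem_filter.1 hx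
    exact Finset.mem_powersetCard.2 ⟨h2, h1⟩
  · intro x _ x' _ h
    funext i
    have := congrArg (fun s => i ∈ s) h
    simp only [Finset.mem_filter, Finset.mem_univ, true_and, eq_iff_iff] at this
    exact Bool.eq_iff_iff.2 this
  · intro s hs
    obtain ⟨h1, h2⟩ := Finset.mem_powersetCard.1 hs
    have e : (Finset.univ.filter fun i => decide (i ∈ s) = true) = s := by ext i; simp
    refine ⟨fun i => decide (i ∈ s), Finset.mem_filter.2 ⟨Finset.mem_univ _, ?_, ?_⟩, e⟩
    · unfold wt; rw [e]; exact h2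
    · rw [e]; exact h1

theorem SD_ge {α : Type*} [Fintype α] (P Q : α → ℝ) (A : Finset α) :
    ∑ x ∈ A, Q x - ∑ x ∈ A, P x ≤ SD P Q := by
  have h1 : ∑ x ∈ A, Q x - ∑ x ∈ A, P x ≤ |∑ x ∈ A, P x - ∑ x ∈ A, Q x| := by
    rw [abs_sub_comm]; exact le_abs_self _
  refine h1.trans ?_
  unfold SD
  exact le_ciSup (f := fun A : Finset α => |∑ x ∈ A, P x - ∑ x ∈ A, Q x|)
    (Set.finite_range _).bddAbove A

theorem core_bound {m n d k L : ℕ} (f : (Fin m → Bool) → (Fin n → Bool))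
    (hf : hasDecisionDepth f d) (R : ℝ)
    (hk : 1 ≤ k) (hkn : k ≤ n) (hL : 2 * k ≤ L) (hR : 256 * (L : ℝ) * (d + 1) ≤ R)
    (B : ℝ) (hB : 2 * (k : ℝ) * R ^ d ≤ B) :
    1 - (B / n) ^ k - n * 2 ^ d / 2 ^ L ≤ SD (srcDist f) (uniformSlice n k) := by
  classical
  choose T hTd hTe using hf
  let good : Finset (Fin m × Bool) → Prop := fun Z =>
    ((Finset.univ.filter fun y : Fin m → Bool =>
        Sat y Z ∧ (Finset.univ.filter fun j => (T j).eval y = true).card ≤ k).card : ℝ) * 2 ^ L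
        ≤ 2 ^ m
  let Fs := (terms T).filter fun p => ¬ ∃ Z, Z ⊆ p.2 ∧ good Z
  have hFs : (Fs.card : ℝ) ≤ B := by
    by_contra hlt
    push Not at hlt
    obtain ⟨Z, ⟨p, hp, hZp⟩, hZ⟩ := exists_kernel T hTd Fs (Finset.filter_subset _ _) R hk hL hR
      (hB.trans hlt.le)
    exact (Finset.mem_filter.1 hp).2 ⟨Z, hZp, hZ⟩
  let J := Fs.image Prod.fst
  have hJ : (J.card : ℝ) ≤ B := le_trans (by exact_mod_cast Finset.card_image_le) hFs
  have hJn : J.card ≤ n := by simpa using Finset.card_le_univ J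
  let A : Finset (Fin n → Bool) := Finset.univ.filter fun x => wt x = k ∧
      ¬ (Finset.univ.filter fun i => x i = true) ⊆ J
  have hn0 : (0 : ℝ) < n := by exact_mod_cast (by omega : 0 < n)
  have hch : (0 : ℝ) < n.choose k := by exact_mod_cast Nat.choose_pos hkn
  -- the slice side
  have hQ : 1 - (B / n) ^ k ≤ ∑ x ∈ A, uniformSlice n k x := by
    have e1 : ∑ x ∈ A, uniformSlice n k x = A.card * (1 / (n.choose k : ℝ)) := by
      rw [← nsmul_eq_mul, ← Finset.sum_const]
      refine Finset.sum_congr rfl fun x hx => ?_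
      unfold uniformSlice
      rw [if_pos (Finset.mem_filter.1 hx).2.1]
    have e2 : J.card.choose k + A.card = n.choose k := by
      rw [← card_slice k J]
      have h2 := card_slice (n := n) k Finset.univ
      simp only [Finset.subset_univ, and_true, Finset.card_univ, Fintype.card_fin] at h2
      rw [← h2, ← Finset.card_filter_add_card_filter_not
        (s := Finset.univ.filter fun x : Fin n → Bool => wt x = k)
        (fun x => (Finset.univ.filter fun i => x i = true) ⊆ J), Finset.filter_filter,
        Finset.filter_filter]
    have e3 : (A.card : ℝ) = n.choose k - J.card.choose k := by
      rw [← e2]; push_cast; ring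
    rw [e1, e3, mul_one_div, sub_div, div_self hch.ne']
    have e4 : ((J.card.choose k : ℕ) : ℝ) / n.choose k ≤ ((J.card : ℝ) / n) ^ k := by
      rw [div_pow, div_le_div_iff₀ hch (by positivity)]
      have := choose_ratio J.card n k hJn
      have h' : ((J.card.choose k * n ^ k : ℕ) : ℝ) ≤ ((n.choose k * J.card ^ k : ℕ) : ℝ) := by
        exact_mod_cast this
      push_cast at h'
      linarith
    have e5 : ((J.card : ℝ) / n) ^ k ≤ (B / n) ^ k := by gcongr
    linarith
  -- the source side
  have hP : ∑ x ∈ A, srcDist f x ≤ n * 2 ^ d / 2 ^ L := by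
    have e1 : ∑ x ∈ A, srcDist f x = ((Finset.univ.filter fun y => f y ∈ A).card : ℝ) / 2 ^ m := by
      unfold srcDist
      rw [← Finset.sum_div]
      congr 1
      norm_cast
      rw [Finset.card_eq_sum_card_fiberwise (f := f) (s := Finset.univ.filter fun y => f y ∈ A) (t := A)
        (fun y hy => (Finset.mem_filter.1 (Finset.mem_coe.1 hy)).2)]
      refine Finset.sum_congr rfl fun x hx => ?_
      congr 1
      ext y
      simp only [Finset.mem_filter, Finset.mem_univ, true_and]
      constructor
      · rintro rfl; exact ⟨hx, rfl⟩
      · exact fun h => h.2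
    have hex : ∀ p : Fin n × Finset (Fin m × Bool), ∃ Z, (∃ Z, Z ⊆ p.2 ∧ good Z) → Z ⊆ p.2 ∧ good Z := by
      intro p
      by_cases h : ∃ Z, Z ⊆ p.2 ∧ good Z
      · obtain ⟨Z, hZ⟩ := h
        exact ⟨Z, fun _ => hZ⟩
      · exact ⟨∅, fun h' => absurd h' h⟩
    choose ζ hζ using hex
    let bad : Fin n × Finset (Fin m × Bool) → Finset (Fin m → Bool) := fun p =>
      Finset.univ.filter fun y : Fin m → Bool =>
        Sat y (ζ p) ∧ (Finset.univ.filter fun j => (T j).eval y = true).card ≤ k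
    let Fg := (terms T).filter fun p => ∃ Z, Z ⊆ p.2 ∧ good Z
    have hsub : (Finset.univ.filter fun y => f y ∈ A) ⊆ Fg.biUnion bad := by
      intro y hy
      obtain ⟨-, hyA⟩ := Finset.mem_filter.1 hy
      obtain ⟨-, hw, hnJ⟩ := Finset.mem_filter.1 hyA
      rw [Finset.not_subset] at hnJ
      obtain ⟨j, hj, hjJ⟩ := hnJ
      have hj := (Finset.mem_filter.1 hj).2
      rw [hTe] at hj
      have hpt : (j, (T j).path y) ∈ terms T :=
        Finset.mem_filter.2 ⟨Finset.mem_univ _, y, hj, rfl⟩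
      have hgood : ∃ Z, Z ⊆ (j, (T j).path y).2 ∧ good Z := by
        by_contra hno
        exact hjJ (Finset.mem_image.2 ⟨_, Finset.mem_filter.2 ⟨hpt, hno⟩, rfl⟩)
      refine Finset.mem_biUnion.2 ⟨_, Finset.mem_filter.2 ⟨hpt, hgood⟩, ?_⟩
      refine Finset.mem_filter.2 ⟨Finset.mem_univ _, ?_, ?_⟩
      · intro l hl
        exact (T j).sat_path y l ((hζ _ hgood).1 hl)
      · unfold wt at hw
        simp only [hTe] at hw
        exact hw.le
    have hc1 : ((Finset.univ.filter fun y => f y ∈ A).card : ℝ) * 2 ^ L ≤ n * 2 ^ d * 2 ^ m := by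
      calc ((Finset.univ.filter fun y => f y ∈ A).card : ℝ) * 2 ^ L
          ≤ (∑ p ∈ Fg, ((bad p).card : ℝ)) * 2 ^ L := by
            refine mul_le_mul_of_nonneg_right ?_ (by positivity)
            exact_mod_cast (Finset.card_le_card hsub).trans Finset.card_biUnion_le
        _ = ∑ p ∈ Fg, ((bad p).card : ℝ) * 2 ^ L := by rw [Finset.sum_mul]
        _ ≤ ∑ p ∈ Fg, (2 : ℝ) ^ m :=
            Finset.sum_le_sum fun p hp => (hζ p (Finset.mem_filter.1 hp).2).2
        _ = Fg.card * 2 ^ m := by simp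
        _ ≤ n * 2 ^ d * 2 ^ m := by
            refine mul_le_mul_of_nonneg_right ?_ (by positivity)
            exact_mod_cast (Finset.card_le_card (Finset.filter_subset _ _)).trans (terms_card T hTd)
    rw [e1, div_le_div_iff₀ (by positivity) (by positivity)]
    exact hc1
  have := SD_ge (srcDist f) (uniformSlice n k) A
  linarith

theorem finish_bound {m n d k : ℕ} (f : (Fin m → Bool) → (Fin n → Bool))
    (hf : hasDecisionDepth f d) (hk : 1 ≤ k) (x K : ℝ) (hx : x = Real.log n)
    (hx1 : 6144 ≤ x) (hK : x ≤ K) (hkK : (k : ℝ) ≤ 2 * K) (hd : (d : ℝ) + 1 ≤ x)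
    (hdK : d * Real.log K ≤ x / 5 / 4) (hk2 : 2 * (k : ℝ) ≤ Real.exp (x / 4)) :
    1 - (n : ℝ) ^ (-(1 / 4 * (k : ℝ))) ≤ SD (srcDist f) (uniformSlice n k) := by
  have hn0 : (0 : ℝ) < n := by
    rcases Nat.eq_zero_or_pos n with h | h
    · subst h; simp at hx; linarith
    · exact_mod_cast h
  have hnx : (n : ℝ) = Real.exp x := by rw [hx, Real.exp_log hn0]
  have hk1 : (1 : ℝ) ≤ k := by exact_mod_cast hk
  have hkn : k ≤ n := by
    have h1 : Real.exp (x / 4) ≤ Real.exp x := Real.exp_le_exp.2 (by linarith)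
    have : (k : ℝ) ≤ n := by rw [hnx]; linarith
    exact_mod_cast this
  set ℓ := ⌈2 * x⌉₊ with hℓ
  have hl1 : 2 * x ≤ ℓ := Nat.le_ceil _
  have hl2 : (ℓ : ℝ) ≤ 3 * x := by
    have := Nat.ceil_lt_add_one (a := 2 * x) (by linarith)
    linarith
  have hlog2 := Real.log_two_gt_d9
  have hlog2' := Real.log_two_lt_d9
  have hd0 : (0 : ℝ) ≤ d := by positivity
  set R : ℝ := 256 * ((4 * k * ℓ : ℕ) : ℝ) * (d + 1) with hR
  have hKpos : 0 < K := by linarith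
  have hRK : R ≤ K ^ 4 := by
    have h1 : R = 1024 * ((k : ℝ) * ℓ * (d + 1)) := by rw [hR]; push_cast; ring
    rw [h1]
    have h2 : (k : ℝ) * ℓ * (d + 1) ≤ (2 * K) * (3 * K) * K := by
      gcongr
      · linarith
      · linarith
    have h3 : 6144 * K ^ 3 ≤ K * K ^ 3 := by
      apply mul_le_mul_of_nonneg_right _ (by positivity); linarith
    nlinarith
  have hℓ1 : 1 ≤ ℓ := by
    have : (1 : ℝ) ≤ ℓ := by linarith
    exact_mod_cast this
  have hRd : R ^ d ≤ Real.exp (x / 5) := by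
    calc R ^ d ≤ (K ^ 4) ^ d := by
          apply pow_le_pow_left₀ _ hRK
          rw [hR]; positivity
      _ = Real.exp (4 * (d * Real.log K)) := by
          rw [← Real.exp_log hKpos, ← Real.exp_nat_mul, ← Real.exp_nat_mul, Real.log_exp]
          congr 1; push_cast; ring
      _ ≤ _ := Real.exp_le_exp.2 (by linarith)
  have hB : 2 * (k : ℝ) * R ^ d ≤ Real.exp (x / 2) := by
    calc 2 * (k : ℝ) * R ^ d ≤ Real.exp (x / 4) * Real.exp (x / 5) := by
          apply mul_le_mul hk2 hRd _ (by positivity)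
          apply pow_nonneg; rw [hR]; positivity
      _ = Real.exp (x / 4 + x / 5) := by rw [Real.exp_add]
      _ ≤ _ := Real.exp_le_exp.2 (by linarith)
  have hmain := core_bound (L := 4 * k * ℓ) f hf R hk hkn (by nlinarith) le_rfl _ hB
  have e1 : (Real.exp (x / 2) / n) ^ k = Real.exp (-(k * x / 2)) := by
    rw [hnx, ← Real.exp_sub, ← Real.exp_nat_mul]; congr 1; ring
  have e2 : (n : ℝ) * 2 ^ d / 2 ^ (4 * k * ℓ) ≤ Real.exp (-(k * x / 2)) := by
    have t1 : (2 : ℝ) ^ d ≤ Real.exp x := by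
      rw [← Real.exp_log (show (0 : ℝ) < 2 by norm_num), ← Real.exp_nat_mul]
      apply Real.exp_le_exp.2
      nlinarith
    have t2 : Real.exp (4 * k * x) ≤ (2 : ℝ) ^ (4 * k * ℓ) := by
      rw [← Real.exp_log (show (0 : ℝ) < 2 by norm_num), ← Real.exp_nat_mul]
      apply Real.exp_le_exp.2
      push_cast
      have : x ≤ ℓ * Real.log 2 := by nlinarith
      calc 4 * (k : ℝ) * x ≤ 4 * k * (ℓ * Real.log 2) := by gcongr
        _ = _ := by ring
    rw [div_le_iff₀ (by positivity)]
    calc (n : ℝ) * 2 ^ d ≤ Real.exp x * Real.exp x := by rw [← hnx] at t1 ⊢; gcongr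
      _ = Real.exp (x + x) := by rw [Real.exp_add]
      _ ≤ Real.exp (-(k * x / 2) + 4 * k * x) := Real.exp_le_exp.2 (by nlinarith)
      _ = Real.exp (-(k * x / 2)) * Real.exp (4 * k * x) := by rw [Real.exp_add]
      _ ≤ _ := by gcongr
  have e3 : (n : ℝ) ^ (-(1 / 4 * (k : ℝ))) = Real.exp (-(k * x / 2)) * Real.exp (k * x / 4) := by
    rw [Real.rpow_def_of_pos hn0, ← hx, ← Real.exp_add]; congr 1; ring
  have e4 : 2 ≤ Real.exp (k * x / 4) := by
    have := Real.add_one_le_exp (k * x / 4)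
    nlinarith
  have e5 : Real.exp (-(k * x / 2)) * 2 ≤ Real.exp (-(k * x / 2)) * Real.exp (k * x / 4) := by
    gcongr
  rw [e1] at hmain
  rw [e3]
  linarith

/-- There are constants `τ', c > 0` such that for every `ε ∈ (0,1)` and all
sufficiently large `n`: (i) for `log₂ n ≤ k ≤ 2^{(log n)^{1-ε}}`, every distribution sampled
with decision depth at most `τ' (log n)^ε` is `(1 - n^{-ck})`-far from `U_k^n`; (ii) for
`1 ≤ k < log₂ n`, every distribution sampled with decision depth at most
`τ' (log n)^ε / log log n` is `(1 - n^{-ck})`-far from `U_k^n`. -/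
theorem stmt8 :
    ∃ τ' c : ℝ, 0 < τ' ∧ 0 < c ∧ ∀ ε : ℝ, 0 < ε → ε < 1 → ∃ N : ℕ, ∀ n : ℕ, N ≤ n →
      (∀ (k m d : ℕ) (f : (Fin m → Bool) → (Fin n → Bool)),
        Real.logb 2 n ≤ (k : ℝ) → (k : ℝ) ≤ (2 : ℝ) ^ ((Real.log n) ^ (1 - ε)) →
        hasDecisionDepth f d → (d : ℝ) ≤ τ' * (Real.log n) ^ ε →
        1 - (n : ℝ) ^ (-(c * (k : ℝ))) ≤ SD (srcDist f) (uniformSlice n k)) ∧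
      (∀ (k m d : ℕ) (f : (Fin m → Bool) → (Fin n → Bool)),
        1 ≤ k → (k : ℝ) < Real.logb 2 n →
        hasDecisionDepth f d → (d : ℝ) ≤ τ' * (Real.log n) ^ ε / Real.log (Real.log n) →
        1 - (n : ℝ) ^ (-(c * (k : ℝ))) ≤ SD (srcDist f) (uniformSlice n k)) := by
  refine ⟨1 / 20, 1 / 4, by norm_num, by norm_num, fun ε hε hε1 => ?_⟩
  have hlim : Filter.Tendsto (fun n : ℕ => Real.log (n : ℝ)) Filter.atTop Filter.atTop :=
    Real.tendsto_log_atTop.comp tendsto_natCast_atTop_atTop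
  obtain ⟨N, hN⟩ := Filter.eventually_atTop.1
    (hlim.eventually_ge_atTop (max 6144 ((8 : ℝ) ^ (1 / ε))))
  refine ⟨N, fun n hn => ?_⟩
  have hxx := hN n hn
  set x := Real.log (n : ℝ) with hx
  have hx1 : 6144 ≤ x := (le_max_left _ _).trans hxx
  have hx8 : (8 : ℝ) ^ (1 / ε) ≤ x := (le_max_right _ _).trans hxx
  have hx0 : 0 < x := by linarith
  have hlog2 := Real.log_two_gt_d9
  have hlog2' := Real.log_two_lt_d9
  have hxe : x ^ ε ≤ x := by
    calc x ^ ε ≤ x ^ (1 : ℝ) := Real.rpow_le_rpow_of_exponent_le (by linarith) hε1.le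
      _ = x := Real.rpow_one x
  have hxe8 : 8 ≤ x ^ ε := by
    have := Real.rpow_le_rpow (by positivity) hx8 hε.le
    rwa [← Real.rpow_mul (by norm_num), one_div_mul_cancel hε.ne', Real.rpow_one] at this
  have hprod : x ^ (1 - ε) * x ^ ε = x := by
    rw [← Real.rpow_add hx0]; simp
  have hpe : 0 < x ^ (1 - ε) := Real.rpow_pos_of_pos hx0 _
  have hlogb : Real.logb 2 n = x / Real.log 2 := rfl
  constructor
  · intro k m d f hk1 hk2 hf hd
    rw [hlogb, div_le_iff₀ (by linarith)] at hk1
    have hkx : x ≤ k := by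
      have : (0 : ℝ) ≤ k := by positivity
      nlinarith
    have hkpos : (0 : ℝ) < k := by linarith
    have hk2' : (k : ℝ) ≤ Real.exp (x ^ (1 - ε)) := by
      refine hk2.trans ?_
      rw [Real.rpow_def_of_pos (by norm_num)]
      apply Real.exp_le_exp.2
      nlinarith
    have hlk : Real.log k ≤ x ^ (1 - ε) := by
      rw [← Real.log_exp (x ^ (1 - ε))]
      exact Real.log_le_log hkpos hk2'
    have hp8 : x ^ (1 - ε) ≤ x / 8 := by nlinarith
    refine finish_bound f hf (by exact_mod_cast (by linarith : (1 : ℝ) ≤ k)) x k hx hx1 hkx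
      (by linarith) (by linarith) ?_ ?_
    · calc (d : ℝ) * Real.log k ≤ (1 / 20 * x ^ ε) * x ^ (1 - ε) :=
            mul_le_mul hd hlk (Real.log_nonneg (by linarith)) (by positivity)
        _ = 1 / 20 * (x ^ (1 - ε) * x ^ ε) := by ring
        _ ≤ _ := by rw [hprod]; linarith
    · calc 2 * (k : ℝ) ≤ Real.exp (x / 8) * Real.exp (x / 8) := by
            apply mul_le_mul _ (hk2'.trans (Real.exp_le_exp.2 hp8)) hkpos.le (by positivity)
            linarith [Real.add_one_le_exp (x / 8)]
        _ = _ := by rw [← Real.exp_add]; congr 1; ring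
  · intro k m d f hk1 hk2 hf hd
    rw [hlogb, lt_div_iff₀ (by linarith)] at hk2
    have hkx : (k : ℝ) ≤ 2 * x := by
      have : (0 : ℝ) ≤ k := by positivity
      nlinarith
    have hlx : 1 ≤ Real.log x := by
      rw [Real.le_log_iff_exp_le hx0]
      linarith [Real.exp_one_lt_d9]
    rw [le_div_iff₀ (by linarith)] at hd
    have hd0 : (0 : ℝ) ≤ d := by positivity
    refine finish_bound f hf hk1 x x hx hx1 le_rfl hkx (by nlinarith) (by linarith) ?_
    have h1 := Real.add_one_le_exp (x / 8)
    calc 2 * (k : ℝ) ≤ (x / 8) * (x / 8) := by nlinarith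
      _ ≤ Real.exp (x / 8) * Real.exp (x / 8) := by
          apply mul_le_mul <;> first | positivity | linarith
      _ = _ := by rw [← Real.exp_add]; congr 1; ring
end

section
/- There exists a constant c > 0 such that for all sufficiently large odd n, every d-local function f : {0,1}^m → {0,1}^n with f({0,1}^m) = {x ∈ {0,1}^n : |x| ≥ n/2} satisfies d ≥ c·√(log n). -/
open Finset

/-- Input bit `i` affects output bit `j` of `f`. -/
def Affects {m n : ℕ} (f : (Fin m → Bool) → (Fin n → Bool)) (i : Fin m) (j : Fin n) : Prop :=
  ∃ x : Fin m → Bool, f x j ≠ f (Function.update x i (!(x i))) j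

instance {m n : ℕ} (f : (Fin m → Bool) → (Fin n → Bool)) (i : Fin m) (j : Fin n) :
    Decidable (Affects f i j) := by unfold Affects; infer_instance

/-- The set of input bits that output bit `j` depends on. -/
def inputsOf {m n : ℕ} (f : (Fin m → Bool) → (Fin n → Bool)) (j : Fin n) : Finset (Fin m) :=
  Finset.univ.filter fun i => Affects f i j

/-- The set of output bits affected by input bit `i`. -/
def outputsOf {m n : ℕ} (f : (Fin m → Bool) → (Fin n → Bool)) (i : Fin m) : Finset (Fin n) :=
  Finset.univ.filter fun j => Affects f i j

/-- `f` is `d`-local: each output bit depends on at most `d` input bits. -/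
def IsLocal {m n : ℕ} (f : (Fin m → Bool) → (Fin n → Bool)) (d : ℕ) : Prop :=
  ∀ j : Fin n, (inputsOf f j).card ≤ d


lemma eq_of_agree {m n : ℕ} (f : (Fin m → Bool) → (Fin n → Bool)) (j : Fin n)
    (y z : Fin m → Bool) (h : ∀ i ∈ inputsOf f j, y i = z i) : f y j = f z j := by
  have key : ∀ s : Finset (Fin m), f (s.piecewise z y) j = f y j := by
    intro s
    induction s using Finset.induction_on with
    | empty => simp
    | insert a s ha ih =>
      rw [Finset.piecewise_insert, ← ih]
      set x := s.piecewise z y with hx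
      by_cases hz : z a = x a
      · rw [hz, Function.update_eq_self]
      · have hna : a ∉ inputsOf f j := by
          intro hmem
          apply hz
          rw [hx, Finset.piecewise_eq_of_notMem _ _ _ ha, h a hmem]
        have hz' : z a = !(x a) := by
          cases hza : z a <;> cases hxa : x a <;> simp_all
        rw [hz']
        by_contra hc
        apply hna
        simp only [inputsOf, Finset.mem_filter, Finset.mem_univ, true_and]
        exact ⟨x, fun e => hc e.symm⟩
  have := key Finset.univ
  rw [Finset.piecewise_univ] at this
  exact this.symm

lemma greedy {n : ℕ} (T : Fin n → Finset (Fin n)) (B : ℕ) (hB : ∀ j, (T j).card ≤ B)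
    (hB1 : 1 ≤ B) (hself : ∀ j, j ∈ T j) (hsymm : ∀ i j, i ∈ T j → j ∈ T i) (t : ℕ) :
    t * B ≤ n → ∃ J : Finset (Fin n), J.card = t ∧ ∀ a ∈ J, ∀ b ∈ J, a ≠ b → a ∉ T b := by
  induction t with
  | zero => intro _; exact ⟨∅, by simp⟩
  | succ t ih =>
    intro h
    rw [Nat.succ_mul] at h
    obtain ⟨J, hJ, hind⟩ := ih (by omega)
    have hc : (J.biUnion T).card ≤ t * B := by
      rw [← hJ]; exact Finset.card_biUnion_le_card_mul _ _ _ (fun j _ => hB j)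
    obtain ⟨j, hj⟩ : ∃ j, j ∉ J.biUnion T := by
      by_contra! hall
      have : J.biUnion T = Finset.univ := Finset.eq_univ_of_forall hall
      rw [this, Finset.card_univ, Fintype.card_fin] at hc
      omega
    simp only [Finset.mem_biUnion, not_exists, not_and] at hj
    have hjJ : j ∉ J := fun hm => hj j hm (hself j)
    refine ⟨insert j J, by rw [Finset.card_insert_of_notMem hjJ, hJ], ?_⟩
    intro a ha b hb hab
    rw [Finset.mem_insert] at ha hb
    rcases ha with rfl | ha <;> rcases hb with rfl | hb
    · exact absurd rfl hab
    · exact hj b hb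
    · exact fun hm => hj a ha (hsymm _ _ hm)
    · exact hind a ha b hb hab

lemma key_bound {n m d k : ℕ} (f : (Fin m → Bool) → (Fin n → Bool)) (hloc : IsLocal f d)
    (hn : n + 1 = 2 * k) (him : ∀ x : Fin n → Bool, (∃ y, f y = x) ↔ k ≤ wt x) (D : ℕ) :
    k ≤ ((Finset.univ.filter fun i => D < (outputsOf f i).card).card + 1) * (1 + d * D) := by
  by_contra! hlt
  set H := Finset.univ.filter fun i => D < (outputsOf f i).card with hH
  set T : Fin n → Finset (Fin n) :=
    fun j => insert j ((inputsOf f j \ H).biUnion (outputsOf f)) with hT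
  have hself : ∀ j, j ∈ T j := fun j => Finset.mem_insert_self _ _
  have hmem : ∀ i j, i ∈ T j ↔ i = j ∨ ∃ a, a ∈ inputsOf f j ∧ a ∉ H ∧ a ∈ inputsOf f i := by
    intro i j
    simp only [hT, Finset.mem_insert, Finset.mem_biUnion, Finset.mem_sdiff, inputsOf, outputsOf,
      Finset.mem_filter, Finset.mem_univ, true_and, and_assoc]
  have hsymm : ∀ i j, i ∈ T j → j ∈ T i := by
    intro i j h
    rw [hmem] at h ⊢
    rcases h with h | ⟨a, h1, h2, h3⟩
    · exact Or.inl h.symm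
    · exact Or.inr ⟨a, h3, h2, h1⟩
  have hB : ∀ j, (T j).card ≤ 1 + d * D := by
    intro j
    have h1 : ((inputsOf f j \ H).biUnion (outputsOf f)).card ≤ (inputsOf f j \ H).card * D := by
      apply Finset.card_biUnion_le_card_mul
      intro i hi
      simp only [hH, Finset.mem_sdiff, Finset.mem_filter, Finset.mem_univ, true_and, not_lt] at hi
      exact hi.2
    have h2 : (inputsOf f j \ H).card ≤ d := (Finset.card_le_card Finset.sdiff_subset).trans (hloc j)
    have h3 := Finset.card_insert_le j ((inputsOf f j \ H).biUnion (outputsOf f))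
    have h4 := Nat.mul_le_mul_right D h2
    simp only [hT]
    omega
  obtain ⟨J, hJ, hind⟩ := greedy T (1 + d * D) hB (by omega) hself hsymm (H.card + 1) (by omega)
  classical
  let g : Finset (Fin m) → Finset (Fin n) := fun P =>
    J.filter fun j => ∀ z : Fin m → Bool, (∀ i ∈ H, (z i = true ↔ i ∈ P)) → f z j = true
  have hsub : J.powerset ⊆ H.powerset.image g := by
    intro S hS
    rw [Finset.mem_powerset] at hS
    -- the string x
    have hU : (S.biUnion T).card ≤ k := by
      have h1 : (S.biUnion T).card ≤ S.card * (1 + d * D) :=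
        Finset.card_biUnion_le_card_mul _ _ _ (fun j _ => hB j)
      have h2 := Nat.mul_le_mul_right (1 + d * D) (Finset.card_le_card hS)
      rw [hJ] at h2
      omega
    have hsubset : S.biUnion T ⊆ (J \ S)ᶜ := by
      intro a ha
      rw [Finset.mem_biUnion] at ha
      obtain ⟨b, hb, hab⟩ := ha
      rw [Finset.mem_compl, Finset.mem_sdiff]
      rintro ⟨haJ, haS⟩
      exact hind a haJ b (hS hb) (fun e => haS (e ▸ hb)) hab
    have hV : k ≤ ((J \ S)ᶜ).card := by
      rw [Finset.card_compl, Fintype.card_fin]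
      have h1 : (J \ S).card ≤ J.card := Finset.card_le_card Finset.sdiff_subset
      have h2 : H.card + 1 ≤ (H.card + 1) * (1 + d * D) := Nat.le_mul_of_pos_right _ (by omega)
      omega
    obtain ⟨X, hX1, hX2, hX3⟩ := Finset.exists_subsuperset_card_eq hsubset hU hV
    have hwt : ∀ x : Fin n → Bool, wt x = (Finset.univ.filter fun i => x i = true).card :=
      fun _ => rfl
    obtain ⟨y, hy⟩ := (him (fun j => decide (j ∈ X))).2 (by rw [hwt]; simp [hX3])
    have hyX : ∀ j, f y j = true ↔ j ∈ X := by intro j; rw [hy]; simp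
    rw [Finset.mem_image]
    refine ⟨H.filter fun i => y i = true, by simp, ?_⟩
    ext j
    simp only [g, Finset.mem_filter]
    constructor
    · rintro ⟨hjJ, hj⟩
      by_contra hjS
      have h1 := (hyX j).1 (hj y (fun i hi => by simp [hi]))
      have := hX2 h1
      rw [Finset.mem_compl, Finset.mem_sdiff] at this
      exact this ⟨hjJ, hjS⟩
    · intro hjS
      refine ⟨hS hjS, fun z hz => ?_⟩
      let z' : Fin m → Bool := (inputsOf f j).piecewise z y
      have e1 : f z' j = f z j := by
        apply eq_of_agree
        intro i hi
        simp [z', hi]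
      have hle : (Finset.univ.filter fun a => f z' a = true) ⊆ X := by
        intro a ha
        rw [Finset.mem_filter] at ha
        by_cases haT : a ∈ T j
        · exact hX1 (Finset.mem_biUnion.2 ⟨j, hjS, haT⟩)
        · rw [← hyX, ← ha.2]
          apply eq_of_agree
          intro i hi
          by_cases hij : i ∈ inputsOf f j
          · have hiH : i ∈ H := by
              by_contra hiH
              exact haT ((hmem a j).2 (Or.inr ⟨i, hij, hiH, hi⟩))
            have := hz i hiH
            simp only [Finset.mem_filter, hiH, true_and] at this
            simp only [z', Finset.piecewise_eq_of_mem _ _ _ hij]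
            exact (Bool.eq_iff_iff.2 this).symm
          · simp [z', hij]
      have hge : k ≤ wt (f z') := (him _).1 ⟨z', rfl⟩
      rw [hwt] at hge
      have heq := Finset.eq_of_subset_of_card_le hle (by rw [hX3]; exact hge)
      have hjX : j ∈ X := hX1 (Finset.mem_biUnion.2 ⟨j, hjS, hself j⟩)
      rw [← heq, Finset.mem_filter] at hjX
      rw [← e1]
      exact hjX.2
  have hcard := (Finset.card_le_card hsub).trans Finset.card_image_le
  rw [Finset.card_powerset, Finset.card_powerset, hJ] at hcard
  have := Nat.pow_lt_pow_right (a := 2) (by norm_num) (Nat.lt_succ_self H.card)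
  exact absurd hcard (not_le.2 this)

lemma sum_bound {n m d : ℕ} (f : (Fin m → Bool) → (Fin n → Bool)) (hloc : IsLocal f d) (M : ℕ) :
    ∑ D ∈ Finset.Icc 1 M, (Finset.univ.filter fun i => D < (outputsOf f i).card).card ≤ n * d := by
  calc ∑ D ∈ Finset.Icc 1 M, (Finset.univ.filter fun i => D < (outputsOf f i).card).card
      = ∑ i, ((Finset.Icc 1 M).filter fun D => D < (outputsOf f i).card).card := by
        simp only [Finset.card_filter]
        exact Finset.sum_comm
    _ ≤ ∑ i, (outputsOf f i).card := by
        apply Finset.sum_le_sum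
        intro i _
        calc _ ≤ (Finset.range (outputsOf f i).card).card := by
              apply Finset.card_le_card
              intro D hD
              simp only [Finset.mem_filter] at hD
              exact Finset.mem_range.2 hD.2
          _ = _ := Finset.card_range _
    _ = ∑ j, (inputsOf f j).card := by
        simp only [outputsOf, inputsOf, Finset.card_filter]
        exact Finset.sum_comm
    _ ≤ ∑ _j : Fin n, d := Finset.sum_le_sum fun j _ => hloc j
    _ = n * d := by simp

/-- There is a constant `c > 0` such that for all sufficiently large odd
`n`, every `d`-local `f : {0,1}^m → {0,1}^n` whose image is exactly
`Maj⁻¹(1) = {x : |x| ≥ n/2}` satisfies `d ≥ c √(log n)`. -/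
theorem stmt14 :
    ∃ c : ℝ, 0 < c ∧ ∃ N : ℕ, ∀ n : ℕ, N ≤ n → Odd n →
      ∀ (m d : ℕ) (f : (Fin m → Bool) → (Fin n → Bool)),
        IsLocal f d →
        (∀ x : Fin n → Bool, (∃ y, f y = x) ↔ (n : ℝ) / 2 ≤ (wt x : ℝ)) →
        c * Real.sqrt (Real.log n) ≤ (d : ℝ) := by
  refine ⟨1 / 4, by norm_num, 8, ?_⟩
  intro n hn hodd m d f hloc him
  obtain ⟨r, hr⟩ := hodd
  have hk : n + 1 = 2 * (r + 1) := by omega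
  have him' : ∀ x : Fin n → Bool, (∃ y, f y = x) ↔ r + 1 ≤ wt x := by
    intro x
    rw [him x, div_le_iff₀ (by norm_num : (0 : ℝ) < 2)]
    have : (n : ℝ) ≤ (wt x : ℝ) * 2 ↔ n ≤ wt x * 2 := by exact_mod_cast Iff.rfl
    rw [this]
    omega
  have hs := sum_bound f hloc n
  have hkb := key_bound f hloc hk him'
  have hnR : (8 : ℝ) ≤ n := by exact_mod_cast hn
  have hterm : ∀ D ∈ Finset.Icc 1 n, (n : ℝ) / (2 * (d + 1)) * (D : ℝ)⁻¹ ≤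
      ((Finset.univ.filter fun i => D < (outputsOf f i).card).card : ℝ) + 1 := by
    intro D hD
    rw [Finset.mem_Icc] at hD
    have h1 := hkb D
    set h := (Finset.univ.filter fun i => D < (outputsOf f i).card).card
    have hD0 : (0 : ℝ) < D := by exact_mod_cast hD.1
    have h2 : (1 + d * D) ≤ (d + 1) * D := by nlinarith [hD.1]
    have h3 : n ≤ 2 * ((h + 1) * ((d + 1) * D)) := by
      have := Nat.mul_le_mul_left (h + 1) h2
      omega
    have h4 : (n : ℝ) ≤ 2 * ((h + 1) * ((d + 1) * D)) := by exact_mod_cast h3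
    rw [← div_eq_mul_inv, div_div, div_le_iff₀ (by positivity)]
    linarith
  have hsum := Finset.sum_le_sum hterm
  rw [← Finset.mul_sum, Finset.sum_add_distrib] at hsum
  have hlog : Real.log n ≤ ∑ D ∈ Finset.Icc 1 n, (D : ℝ)⁻¹ := by
    have h1 := log_add_one_le_harmonic n
    rw [harmonic_eq_sum_Icc] at h1
    push_cast at h1
    refine le_trans (Real.log_le_log (by linarith) (by linarith)) h1
  have hs' : (∑ D ∈ Finset.Icc 1 n,
      ((Finset.univ.filter fun i => D < (outputsOf f i).card).card : ℝ)) ≤ n * d := by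
    exact_mod_cast hs
  have hmain : (n : ℝ) / (2 * (d + 1)) * Real.log n ≤ n * d + n := by
    refine le_trans (mul_le_mul_of_nonneg_left hlog (by positivity)) (hsum.trans ?_)
    simp only [Finset.sum_const, Nat.card_Icc, nsmul_eq_mul, mul_one, Nat.add_sub_cancel]
    linarith
  have hd0 : (0 : ℝ) ≤ d := Nat.cast_nonneg d
  have hfin : Real.log n ≤ 2 * ((d : ℝ) + 1) ^ 2 := by
    rw [div_mul_eq_mul_div, div_le_iff₀ (by positivity)] at hmain
    have hn0 : (0 : ℝ) < n := by linarith
    refine le_of_mul_le_mul_left ?_ hn0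
    nlinarith
  have hd1 : (1 : ℝ) ≤ d := by
    rcases Nat.eq_zero_or_pos d with h0 | h0
    · exfalso
      rw [h0] at hfin
      norm_num at hfin
      have h8 : Real.log 8 ≤ Real.log n := Real.log_le_log (by norm_num) hnR
      have h88 : Real.log 8 = 3 * Real.log 2 := by
        rw [show (8 : ℝ) = 2 ^ 3 by norm_num, Real.log_pow]; norm_num
      have := Real.log_two_gt_d9
      linarith
    · exact_mod_cast h0
  have hsq : Real.sqrt (Real.log n) ≤ 4 * d := by
    apply Real.sqrt_le_iff.2
    refine ⟨by linarith, ?_⟩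
    nlinarith
  linarith
end

section
/- Let α ∈ (0,1) be a constant. For every ε > 0 there exists a constant M such that the following holds for all n with αn an integer and all c, d ≥ 1 with n ≥ M·(cd)²·2^{cd}: if X = f(Y) where Y is uniform on {0,1}^m, f has decision depth d, each input bit of f affects at most c output bits, and the support of X is contained in {x ∈ {0,1}^n : |x| = αn}, then Δ(X, U_{αn}^n) ≥ 1 − ε. -/
open Finset

/-- Average of `g` over the finite set `S`. -/
noncomputable def Ex {Ω : Type*} (S : Finset Ω) (g : Ω → ℝ) : ℝ := (∑ x ∈ S, g x) / (S.card : ℝ)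

section ExLemmas

variable {Ω : Type*} {S : Finset Ω}

lemma Ex_congr {g h : Ω → ℝ} (H : ∀ x ∈ S, g x = h x) : Ex S g = Ex S h := by
  unfold Ex; rw [Finset.sum_congr rfl H]

lemma Ex_add (g h : Ω → ℝ) : Ex S (fun x => g x + h x) = Ex S g + Ex S h := by
  unfold Ex; rw [Finset.sum_add_distrib, add_div]

lemma Ex_sub (g h : Ω → ℝ) : Ex S (fun x => g x - h x) = Ex S g - Ex S h := by
  unfold Ex; rw [Finset.sum_sub_distrib, sub_div]

lemma Ex_neg (g : Ω → ℝ) : Ex S (fun x => - g x) = - Ex S g := by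
  unfold Ex; rw [Finset.sum_neg_distrib, neg_div]

lemma Ex_mul (a : ℝ) (g : Ω → ℝ) : Ex S (fun x => a * g x) = a * Ex S g := by
  unfold Ex; rw [← Finset.mul_sum, mul_div_assoc]

lemma Ex_sum {ι : Type*} (I : Finset ι) (g : ι → Ω → ℝ) :
    Ex S (fun x => ∑ i ∈ I, g i x) = ∑ i ∈ I, Ex S (g i) := by
  unfold Ex; rw [Finset.sum_comm, Finset.sum_div]

lemma Ex_mono {g h : Ω → ℝ} (H : ∀ x ∈ S, g x ≤ h x) : Ex S g ≤ Ex S h := by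
  unfold Ex
  exact div_le_div_of_nonneg_right (Finset.sum_le_sum H) (Nat.cast_nonneg _)

lemma Ex_const (hS : S.Nonempty) (a : ℝ) : Ex S (fun _ => a) = a := by
  unfold Ex
  have : (S.card : ℝ) ≠ 0 := by exact_mod_cast hS.card_pos.ne'
  rw [Finset.sum_const, nsmul_eq_mul]; field_simp

lemma abs_Ex_le (hS : S.Nonempty) {g : Ω → ℝ} {a : ℝ} (H : ∀ x ∈ S, |g x| ≤ a) : |Ex S g| ≤ a := by
  rw [abs_le]
  constructor
  · rw [← Ex_const hS (-a)]
    exact Ex_mono fun x hx => (abs_le.1 (H x hx)).1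
  · rw [← Ex_const hS a]
    exact Ex_mono fun x hx => (abs_le.1 (H x hx)).2

/-- Chebyshev inequality. -/
lemma Ex_cheb (g : Ω → ℝ) (t e : ℝ) (ht : 0 < t) (H : Ex S (fun x => g x ^ 2) ≤ e * t ^ 2) 
    (P : Ω → Prop) [DecidablePred P] (hP : ∀ x ∈ S, P x → t ≤ |g x|) :
    ((S.filter P).card : ℝ) / S.card ≤ e := by
  have h1 : t ^ 2 * (((S.filter P).card : ℝ) / S.card) ≤ Ex S (fun x => g x ^ 2) := by
    unfold Ex
    rw [← mul_div_assoc]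
    refine div_le_div_of_nonneg_right ?_ (Nat.cast_nonneg _)
    calc t ^ 2 * ((S.filter P).card : ℝ) = ∑ x ∈ S.filter P, t ^ 2 := by
          rw [Finset.sum_const, nsmul_eq_mul, mul_comm]
      _ ≤ ∑ x ∈ S.filter P, g x ^ 2 := by
          refine Finset.sum_le_sum fun x hx => ?_
          rw [Finset.mem_filter] at hx
          have := hP x hx.1 hx.2
          rw [← sq_abs (g x)]
          gcongr
      _ ≤ ∑ x ∈ S, g x ^ 2 :=
          Finset.sum_le_sum_of_subset_of_nonneg (Finset.filter_subset _ _) fun _ _ _ => sq_nonneg _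
  have h2 : t ^ 2 * (((S.filter P).card : ℝ) / S.card) ≤ t ^ 2 * e := by linarith
  exact le_of_mul_le_mul_left h2 (by positivity)

end ExLemmas

/-- The hslice as a finset. -/
def hslice (n k : ℕ) : Finset (Fin n → Bool) := Finset.univ.filter fun x => wt x = k

lemma mem_hslice {n k : ℕ} {x : Fin n → Bool} : x ∈ hslice n k ↔ wt x = k := by
  simp [hslice]

lemma card_slice_s18 (n k : ℕ) : (hslice n k).card = n.choose k := by
  have : (Finset.powersetCard k (Finset.univ : Finset (Fin n))).card = n.choose k := by simp
  rw [← this]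
  refine Finset.card_bij' (fun x _ => Finset.univ.filter fun i => x i = true)
    (fun s _ => fun i => decide (i ∈ s)) ?_ ?_ ?_ ?_
  · intro x hx
    rw [mem_hslice] at hx
    rw [Finset.mem_powersetCard]
    exact ⟨Finset.subset_univ _, hx⟩
  · intro s hs
    rw [Finset.mem_powersetCard] at hs
    rw [mem_hslice, ← hs.2]
    unfold wt
    congr 1
    ext i; simp
  · intro x hx
    ext i; simp
  · intro s hs
    ext i; simp

/-- Distinguisher lemma. -/
lemma sd_of_test {m n k : ℕ} (hk : k ≤ n) (f : (Fin m → Bool) → (Fin n → Bool)) (ε t : ℝ) (ht : 0 < t)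
    (T : (Fin n → Bool) → ℝ)
    (hX : Ex Finset.univ (fun y => T (f y) ^ 2) ≤ (ε / 2) * t ^ 2)
    (hU : Ex (hslice n k) (fun x => (T x - 2 * t) ^ 2) ≤ (ε / 2) * t ^ 2) :
    1 - ε ≤ SD (srcDist f) (uniformSlice n k) := by
  classical
  have hne : (hslice n k).Nonempty := by
    rw [← Finset.card_pos, card_slice_s18]; exact Nat.choose_pos hk
  set A : Finset (Fin n → Bool) := Finset.univ.filter fun x => T x < t with hA
  have h1 : 1 - ε / 2 ≤ ∑ x ∈ A, srcDist f x := by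
    have e1 : ∑ x ∈ A, srcDist f x
        = ((Finset.univ.filter fun y : Fin m → Bool => T (f y) < t).card : ℝ) / 2 ^ m := by
      unfold srcDist
      rw [← Finset.sum_div]
      congr 1
      rw [← Nat.cast_sum]
      congr 1
      rw [Finset.card_eq_sum_card_fiberwise (f := f) (t := A)]
      · refine Finset.sum_congr rfl fun x hx => ?_
        congr 1
        ext y
        simp only [hA, Finset.mem_filter, Finset.mem_univ, true_and] at hx ⊢
        constructor
        · rintro rfl; exact ⟨hx, rfl⟩
        · exact fun h => h.2
      · intro y hy
        simpa [hA] using hy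
    have e2 := Ex_cheb (S := (Finset.univ : Finset (Fin m → Bool)))
      (fun y => T (f y)) t (ε / 2) ht hX (fun y => ¬ T (f y) < t)
      (fun y _ h => (not_lt.1 h).trans (le_abs_self _))
    have e3 := Finset.card_filter_add_card_filter_not (s := (Finset.univ : Finset (Fin m → Bool)))
      (fun y => T (f y) < t)
    have e4 : ((Finset.univ : Finset (Fin m → Bool)).card : ℝ) = 2 ^ m := by simp
    rw [e4] at e2
    have e5 : ((Finset.univ.filter fun y : Fin m → Bool => T (f y) < t).card : ℝ) +
      ((Finset.univ.filter fun y : Fin m → Bool => ¬ T (f y) < t).card : ℝ) = 2 ^ m := by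
      rw [← e4, ← e3]; push_cast; rfl
    rw [e1]
    have e6 : ((Finset.univ.filter fun y : Fin m → Bool => T (f y) < t).card : ℝ) / 2 ^ m +
      ((Finset.univ.filter fun y : Fin m → Bool => ¬ T (f y) < t).card : ℝ) / 2 ^ m = 1 := by
      rw [← add_div, e5]; exact div_self (by positivity)
    linarith
  have h2 : ∑ x ∈ A, uniformSlice n k x ≤ ε / 2 := by
    have e2 := Ex_cheb (S := hslice n k) (fun x => T x - 2 * t) t (ε / 2) ht hU
      (fun x => T x < t) (fun x _ h => by
        have h : T x < t := h
        rw [abs_sub_comm]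
        exact le_trans (by linarith) (le_abs_self _))
    refine le_trans (le_of_eq ?_) e2
    unfold uniformSlice
    rw [← Finset.sum_filter, Finset.sum_const, nsmul_eq_mul, card_slice_s18, mul_one_div]
    congr 2
    congr 1
    ext x
    simp only [hA, hslice, Finset.mem_filter, Finset.mem_univ, true_and]
    tauto
  have h3 : |∑ x ∈ A, srcDist f x - ∑ x ∈ A, uniformSlice n k x| ≤
      SD (srcDist f) (uniformSlice n k) := by
    unfold SD
    exact le_ciSup (f := fun A : Finset (Fin n → Bool) =>
      |∑ x ∈ A, srcDist f x - ∑ x ∈ A, uniformSlice n k x|) (Set.finite_range _).bddAbove A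
  have h4 := le_abs_self (∑ x ∈ A, srcDist f x - ∑ x ∈ A, uniformSlice n k x)
  linarith

/-- `g` depends only on the inputs in `A`. -/
def DepOn {m : ℕ} {β : Type*} (A : Finset (Fin m)) (g : (Fin m → Bool) → β) : Prop :=
  ∀ y y' : Fin m → Bool, (∀ i ∈ A, y i = y' i) → g y = g y'

lemma indep_prod_s18 {m : ℕ} {A B : Finset (Fin m)} (hAB : Disjoint A B) (g h : (Fin m → Bool) → ℝ)
    (hg : DepOn A g) (hh : DepOn B h) :
    Ex Finset.univ (fun y => g y * h y) = Ex Finset.univ g * Ex Finset.univ h := by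
  classical
  let sw : (Fin m → Bool) × (Fin m → Bool) → (Fin m → Bool) × (Fin m → Bool) := fun p =>
    (fun i => if i ∈ A then p.2 i else p.1 i, fun i => if i ∈ A then p.1 i else p.2 i)
  have hsw : Function.Involutive sw := by
    intro p
    ext i
    · by_cases h : i ∈ A <;> simp [sw, h]
    · by_cases h : i ∈ A <;> simp [sw, h]
  have key : ∑ p : (Fin m → Bool) × (Fin m → Bool), g p.1 * h p.2
      = ∑ p : (Fin m → Bool) × (Fin m → Bool), g p.2 * h p.2 := by
    rw [← Equiv.sum_comp (hsw.toPerm sw)]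
    refine Finset.sum_congr rfl fun p _ => ?_
    have e1 : g (sw p).1 = g p.2 := hg _ _ fun i hi => by simp [sw, hi]
    have e2 : h (sw p).2 = h p.2 := hh _ _ fun i hi => by
      have : i ∉ A := Finset.disjoint_right.1 hAB hi
      simp [sw, this]
    show g (sw p).1 * h (sw p).2 = _
    rw [e1, e2]
  rw [Fintype.sum_prod_type, Fintype.sum_prod_type] at key
  simp only [← Finset.mul_sum, ← Finset.sum_mul] at key
  rw [Finset.sum_const, nsmul_eq_mul] at key
  unfold Ex
  have hc : ((Finset.univ : Finset (Fin m → Bool)).card : ℝ) ≠ 0 := by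
    exact_mod_cast (Finset.card_pos.2 Finset.univ_nonempty).ne'
  rw [div_mul_div_comm, key]
  field_simp

lemma depOn_output {m n : ℕ} (f : (Fin m → Bool) → (Fin n → Bool)) (j : Fin n) :
    DepOn (inputsOf f j) (fun y => f y j) := by
  classical
  intro y y' hyy
  have key : ∀ s : Finset (Fin m), f (fun i => if i ∈ s then y' i else y i) j = f y j := by
    intro s
    induction s using Finset.induction_on with
    | empty => simp
    | insert a s ha ih =>
      rw [← ih]
      set z : Fin m → Bool := fun i => if i ∈ s then y' i else y i with hz
      have hz' : (fun i => if i ∈ insert a s then y' i else y i) = Function.update z a (y' a) := by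
        ext i
        by_cases h : i = a
        · subst h; simp
        · simp [hz, h]
      rw [hz']
      have hza : z a = y a := by simp [hz, ha]
      by_cases h : y' a = y a
      · rw [h, ← hza, Function.update_eq_self]
      · have haf : ¬ Affects f a j := by
          intro hA
          exact h (hyy a (by simp [inputsOf, hA])).symm
        have h2 : y' a = !(z a) := by
          rw [hza]; cases h3 : y' a <;> cases h4 : y a <;> simp_all
        rw [h2]
        by_contra hne
        exact haf ⟨z, fun h => hne h.symm⟩
  have := key Finset.univ
  simp only [Finset.mem_univ, if_true] at this
  exact this.symm

/-- Outputs that share an input (or are equal). -/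
def Nb {m n : ℕ} (f : (Fin m → Bool) → (Fin n → Bool)) (j : Fin n) : Finset (Fin n) :=
  Finset.univ.filter fun l => l = j ∨ ∃ i, Affects f i j ∧ Affects f i l

lemma Nb_symm {m n : ℕ} (f : (Fin m → Bool) → (Fin n → Bool)) {j l : Fin n} :
    l ∈ Nb f j ↔ j ∈ Nb f l := by
  simp only [Nb, Finset.mem_filter, Finset.mem_univ, true_and]
  constructor <;>
  · rintro (h | ⟨i, h1, h2⟩)
    · exact Or.inl h.symm
    · exact Or.inr ⟨i, h2, h1⟩

lemma Nb_self {m n : ℕ} (f : (Fin m → Bool) → (Fin n → Bool)) (j : Fin n) : j ∈ Nb f j := by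
  simp [Nb]

lemma disj_of_not_Nb {m n : ℕ} (f : (Fin m → Bool) → (Fin n → Bool)) {j l : Fin n}
    (h : l ∉ Nb f j) : Disjoint (inputsOf f j) (inputsOf f l) := by
  rw [Finset.disjoint_left]
  intro i h1 h2
  simp only [inputsOf, Finset.mem_filter, Finset.mem_univ, true_and] at h1 h2
  exact h (by simp only [Nb, Finset.mem_filter, Finset.mem_univ, true_and]; exact Or.inr ⟨i, h1, h2⟩)

/-- Variables queried by a tree. -/
def DTree.vars {m : ℕ} : DTree m → Finset (Fin m)
  | .leaf _ => ∅
  | .node i t0 t1 => insert i (t0.vars ∪ t1.vars)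

lemma DTree.card_vars {m : ℕ} (t : DTree m) : t.vars.card + 1 ≤ 2 ^ t.depth := by
  induction t with
  | leaf b => simp [DTree.vars, DTree.depth]
  | node i t0 t1 h0 h1 =>
    simp only [DTree.vars, DTree.depth]
    have a1 := Finset.card_insert_le i (t0.vars ∪ t1.vars)
    have a2 := Finset.card_union_le t0.vars t1.vars
    have a3 : 2 ^ t0.depth ≤ 2 ^ (max t0.depth t1.depth) :=
      Nat.pow_le_pow_right (by norm_num) (le_max_left _ _)
    have a4 : 2 ^ t1.depth ≤ 2 ^ (max t0.depth t1.depth) :=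
      Nat.pow_le_pow_right (by norm_num) (le_max_right _ _)
    rw [pow_succ]
    omega

lemma DTree.eval_congr {m : ℕ} (t : DTree m) (y y' : Fin m → Bool)
    (h : ∀ i ∈ t.vars, y i = y' i) : t.eval y = t.eval y' := by
  induction t with
  | leaf b => rfl
  | node i t0 t1 h0 h1 =>
    simp only [DTree.vars, Finset.mem_insert, Finset.mem_union] at h
    simp only [DTree.eval]
    rw [h i (Or.inl rfl), h0 fun i hi => h i (Or.inr (Or.inl hi)),
      h1 fun i hi => h i (Or.inr (Or.inr hi))]

lemma card_inputs {m n d : ℕ} (f : (Fin m → Bool) → (Fin n → Bool)) (hf : hasDecisionDepth f d)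
    (j : Fin n) : (inputsOf f j).card + 1 ≤ 2 ^ d := by
  obtain ⟨t, ht, h⟩ := hf j
  have hsub : inputsOf f j ⊆ t.vars := by
    intro i hi
    simp only [inputsOf, Finset.mem_filter, Finset.mem_univ, true_and] at hi
    obtain ⟨x, hx⟩ := hi
    by_contra hni
    apply hx
    rw [h, h]
    apply DTree.eval_congr
    intro i' hi'
    rw [Function.update_of_ne]
    rintro rfl; exact hni hi'
  have a1 := Finset.card_le_card hsub
  have a2 := t.card_vars
  have a3 : 2 ^ t.depth ≤ 2 ^ d := Nat.pow_le_pow_right (by norm_num) ht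
  omega

lemma card_Nb_gen {m n c d : ℕ} (hc : 1 ≤ c) (f : (Fin m → Bool) → (Fin n → Bool))
    (hf : hasDecisionDepth f d) (ho : ∀ i : Fin m, (outputsOf f i).card ≤ c) (j : Fin n) :
    (Nb f j).card ≤ c * 2 ^ d := by
  classical
  have hsub : Nb f j ⊆ insert j ((inputsOf f j).biUnion (outputsOf f)) := by
    intro l hl
    simp only [Nb, Finset.mem_filter, Finset.mem_univ, true_and] at hl
    rw [Finset.mem_insert, Finset.mem_biUnion]
    rcases hl with h | ⟨i, h1, h2⟩
    · exact Or.inl h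
    · exact Or.inr ⟨i, by simp [inputsOf, h1], by simp [outputsOf, h2]⟩
  have a1 := Finset.card_le_card hsub
  have a2 := Finset.card_insert_le j ((inputsOf f j).biUnion (outputsOf f))
  have a3 := Finset.card_biUnion_le_card_mul (inputsOf f j) (outputsOf f) c fun i _ => ho i
  have a4 := card_inputs f hf j
  have a5 : c * ((inputsOf f j).card + 1) ≤ c * 2 ^ d := Nat.mul_le_mul_left _ a4
  rw [mul_add, mul_comm c] at a5
  omega

lemma card_Nb_one {m n : ℕ} (f : (Fin m → Bool) → (Fin n → Bool))
    (ho : ∀ i : Fin m, (outputsOf f i).card ≤ 1) (j : Fin n) :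
    (Nb f j).card ≤ 1 := by
  have : Nonempty (Fin n) := ⟨j⟩
  rw [Finset.card_le_one_iff_subset_singleton]
  refine ⟨j, fun l hl => ?_⟩
  simp only [Nb, Finset.mem_filter, Finset.mem_univ, true_and] at hl
  rw [Finset.mem_singleton]
  rcases hl with h | ⟨i, h1, h2⟩
  · exact h
  · exact Finset.card_le_one.1 (ho i) _ (by simp [outputsOf, h2]) _ (by simp [outputsOf, h1])

/-- flip of an input bit -/
def flp {m : ℕ} (y : Fin m → Bool) (i : Fin m) : Fin m → Bool := Function.update y i (!(y i))

lemma flp_ne {m : ℕ} (y : Fin m → Bool) {i l : Fin m} (h : l ≠ i) : flp y i l = y l := by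
  unfold flp; exact Function.update_of_ne h _ _

/-- real value of an output -/
def rv (b : Bool) : ℝ := if b then 1 else 0

lemma wt_eq_sum {n : ℕ} (x : Fin n → Bool) : (wt x : ℝ) = ∑ j, rv (x j) := by
  simp [wt, rv]

lemma flip_pair {m n k : ℕ} (f : (Fin m → Bool) → (Fin n → Bool)) (hw : ∀ y, wt (f y) = k)
    {i : Fin m} {j l : Fin n} (hjl : j ≠ l) (hi : ∀ o, Affects f i o → o = j ∨ o = l)
    (y : Fin m → Bool) :
    rv (f (flp y i) j) - rv (f y j) = -(rv (f (flp y i) l) - rv (f y l)) := by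
  have h : ∑ o, (rv (f (flp y i) o) - rv (f y o)) = 0 := by
    rw [Finset.sum_sub_distrib, ← wt_eq_sum, ← wt_eq_sum, hw, hw, sub_self]
  rw [Fintype.sum_eq_add j l hjl] at h
  · linarith
  · intro o ⟨ho1, ho2⟩
    have : ¬ Affects f i o := fun h => (hi o h).elim ho1 ho2
    have : f y o = f (flp y i) o := by
      by_contra hne
      exact this ⟨y, hne⟩
    rw [this, sub_self]

lemma card_Nb_two {m n k : ℕ} (f : (Fin m → Bool) → (Fin n → Bool)) (hw : ∀ y, wt (f y) = k)
    (ho : ∀ i : Fin m, (outputsOf f i).card ≤ 2) (j : Fin n) :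
    (Nb f j).card ≤ 2 := by
  classical
  by_contra hcard
  push Not at hcard
  obtain ⟨l1, hl1, l2, hl2, h1j, h2j, h12⟩ : ∃ l1 ∈ Nb f j, ∃ l2 ∈ Nb f j, l1 ≠ j ∧ l2 ≠ j ∧ l1 ≠ l2 := by
    have : 1 < ((Nb f j).erase j).card := by
      rw [Finset.card_erase_of_mem (Nb_self f j)]; omega
    obtain ⟨a, ha, b, hb, hab⟩ := Finset.one_lt_card.1 this
    rw [Finset.mem_erase] at ha hb
    exact ⟨a, ha.2, b, hb.2, ha.1, hb.1, hab⟩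
  simp only [Nb, Finset.mem_filter, Finset.mem_univ, true_and, h1j, h2j, false_or] at hl1 hl2
  obtain ⟨i1, hi1j, hi1l⟩ := hl1
  obtain ⟨i2, hi2j, hi2l⟩ := hl2
  have only : ∀ (i : Fin m) (a b : Fin n), a ≠ b → Affects f i a → Affects f i b →
      ∀ o, Affects f i o → o = a ∨ o = b := by
    intro i a b hab ha hb o hoo
    by_contra hne
    push Not at hne
    have : ({a, b, o} : Finset (Fin n)) ⊆ outputsOf f i := by
      intro x hx
      simp only [Finset.mem_insert, Finset.mem_singleton] at hx
      rcases hx with rfl | rfl | rfl <;> simp [outputsOf, *]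
    have h3 := Finset.card_le_card this
    rw [Finset.card_eq_three.2 ⟨a, b, o, hab, hne.1.symm, hne.2.symm, rfl⟩] at h3
    have := ho i
    omega
  have o1 := only i1 j l1 h1j.symm hi1j hi1l
  have o2 := only i2 j l2 h2j.symm hi2j hi2l
  have dep1 : ∀ z z' : Fin m → Bool, (∀ i, Affects f i j → Affects f i l1 → z i = z' i) →
      rv (f (flp z i1) j) - rv (f z j) = rv (f (flp z' i1) j) - rv (f z' j) := by
    intro z z' hzz
    let w : Fin m → Bool := fun i => if Affects f i l1 then z' i else z i
    have wj : f w j = f z j ∧ f (flp w i1) j = f (flp z i1) j := by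
      have hwz : ∀ i, Affects f i j → w i = z i := by
        intro i hi
        by_cases h : Affects f i l1
        · simp [w, h, hzz i hi h]
        · simp [w, h]
      refine ⟨depOn_output f j _ _ fun i hi => ?_, depOn_output f j _ _ fun i hi => ?_⟩
      · simp only [inputsOf, Finset.mem_filter, Finset.mem_univ, true_and] at hi
        exact hwz i hi
      · simp only [inputsOf, Finset.mem_filter, Finset.mem_univ, true_and] at hi
        by_cases h : i = i1
        · subst h; simp [flp, hwz i hi]
        · rw [flp_ne _ h, flp_ne _ h, hwz i hi]
    have wl : f w l1 = f z' l1 ∧ f (flp w i1) l1 = f (flp z' i1) l1 := by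
      have hwz : ∀ i, Affects f i l1 → w i = z' i := by
        intro i hi
        simp [w, hi]
      refine ⟨depOn_output f l1 _ _ fun i hi => ?_, depOn_output f l1 _ _ fun i hi => ?_⟩
      · simp only [inputsOf, Finset.mem_filter, Finset.mem_univ, true_and] at hi
        exact hwz i hi
      · simp only [inputsOf, Finset.mem_filter, Finset.mem_univ, true_and] at hi
        by_cases h : i = i1
        · subst h; simp [flp, hwz i hi]
        · rw [flp_ne _ h, flp_ne _ h, hwz i hi]
    have e1 := flip_pair f hw h1j.symm o1 w
    have e2 := flip_pair f hw h1j.symm o1 z'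
    rw [wj.1, wj.2, wl.1, wl.2] at e1
    rw [e1, e2]
  obtain ⟨y, hy⟩ := hi1j
  obtain ⟨y', hy'⟩ := hi2j
  let z : Fin m → Bool := fun i => if Affects f i j ∧ Affects f i l1 then y i else y' i
  have hz1 := dep1 z y (fun i h1 h2 => by simp [z, h1, h2])
  have hi2n : ¬ (Affects f i2 l1) := by
    intro h
    rcases o2 l1 h with h | h
    · exact h1j h
    · exact h12 h
  have hz2 := dep1 (flp z i2) z (fun i h1 h2 => by
    rw [flp_ne]
    rintro rfl; exact hi2n h2)
  have e3 := flip_pair f hw h2j.symm o2 z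
  have e4 := flip_pair f hw h2j.symm o2 y'
  have hzl2 : ∀ i, Affects f i l2 → z i = y' i := by
    intro i hi
    have : ¬ (Affects f i j ∧ Affects f i l1) := by
      rintro ⟨ha, hb⟩
      rcases only i j l1 h1j.symm ha hb l2 hi with h | h
      · exact h2j h
      · exact h12 h.symm
    simp [z, this]
  have e5 : f z l2 = f y' l2 := depOn_output f l2 _ _ fun i hi => by
    simp only [inputsOf, Finset.mem_filter, Finset.mem_univ, true_and] at hi
    exact hzl2 i hi
  have e6 : f (flp z i2) l2 = f (flp y' i2) l2 := depOn_output f l2 _ _ fun i hi => by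
    simp only [inputsOf, Finset.mem_filter, Finset.mem_univ, true_and] at hi
    by_cases h : i = i2
    · subst h; simp [flp, hzl2 i hi]
    · rw [flp_ne _ h, flp_ne _ h, hzl2 i hi]
  rw [e5, e6, ← e4] at e3
  change f y j ≠ f (flp y i1) j at hy
  change f y' j ≠ f (flp y' i2) j at hy'
  generalize f y j = b1 at *
  generalize f (flp y i1) j = b2 at *
  generalize f y' j = b3 at *
  generalize f (flp y' i2) j = b4 at *
  generalize f z j = b5 at *
  generalize f (flp z i1) j = b6 at *
  generalize f (flp z i2) j = b7 at *
  generalize f (flp (flp z i2) i1) j = b8 at *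
  clear e4 e5 e6 dep1 only o1 o2 hw
  revert hz1 hz2 e3 hy hy'
  clear * -
  cases b1 <;> cases b2 <;> simp [rv] <;> cases b3 <;> cases b4 <;> simp <;> cases b5 <;> cases b6 <;>
    norm_num <;> cases b7 <;> norm_num <;> cases b8 <;> norm_num

/-- centered coordinate -/
def uc {n : ℕ} (α : ℝ) (x : Fin n → Bool) (j : Fin n) : ℝ := rv (x j) - α

lemma abs_uc_le {n : ℕ} {α : ℝ} (h0 : 0 < α) (h1 : α < 1) (x : Fin n → Bool) (j : Fin n) :
    |uc α x j| ≤ 1 := by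
  unfold uc rv
  rw [abs_le]
  split_ifs <;> constructor <;> linarith

lemma sum_uc {n k : ℕ} {α : ℝ} (hk : (k : ℝ) = α * n) {x : Fin n → Bool} (hx : x ∈ hslice n k) :
    ∑ j, uc α x j = 0 := by
  have : wt x = k := by simpa [hslice] using hx
  unfold uc
  rw [Finset.sum_sub_distrib, ← wt_eq_sum, this, hk]
  simp [mul_comm]

lemma sum_uc_sq {n k : ℕ} {α : ℝ} (hk : (k : ℝ) = α * n) {x : Fin n → Bool} (hx : x ∈ hslice n k) :
    ∑ j, uc α x j * uc α x j = n * (α * (1 - α)) := by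
  have hw : wt x = k := by simpa [hslice] using hx
  have : ∀ j, uc α x j * uc α x j = (1 - 2 * α) * rv (x j) + α ^ 2 := by
    intro j
    unfold uc rv
    split_ifs <;> ring
  simp only [this]
  rw [Finset.sum_add_distrib, ← Finset.mul_sum, ← wt_eq_sum, hw, hk]
  simp
  ring

lemma Ex_swap {n k : ℕ} (σ : Equiv.Perm (Fin n)) (g : (Fin n → Bool) → ℝ) :
    Ex (hslice n k) (fun x => g (x ∘ σ)) = Ex (hslice n k) g := by
  unfold Ex
  congr 1
  refine Finset.sum_bij' (fun x _ => x ∘ σ) (fun x _ => x ∘ σ.symm) ?_ ?_ ?_ ?_ ?_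
  · intro x hx
    simp only [hslice, Finset.mem_filter, Finset.mem_univ, true_and] at hx ⊢
    rw [← hx]
    unfold wt
    exact Finset.card_bij (fun i _ => σ i) (by simp) (by simp)
      (fun b hb => ⟨σ.symm b, by simpa using hb, by simp⟩)
  · intro x hx
    simp only [hslice, Finset.mem_filter, Finset.mem_univ, true_and] at hx ⊢
    rw [← hx]
    unfold wt
    exact Finset.card_bij (fun i _ => σ.symm i) (by simp) (by simp)
      (fun b hb => ⟨σ b, by simpa using hb, by simp⟩)
  · intro x _; ext i; simp
  · intro x _; ext i; simp
  · intro x _; rfl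

lemma Ex_mul_uc {n k : ℕ} {α : ℝ} (hk : (k : ℝ) = α * n) (F : Finset (Fin n))
    (g : (Fin n → Bool) → ℝ)
    (hg : ∀ x x' : Fin n → Bool, (∀ i ∈ F, x i = x' i) → g x = g x')
    {l : Fin n} (hl : l ∉ F) :
    ((n : ℝ) - F.card) * Ex (hslice n k) (fun x => g x * uc α x l)
      = - ∑ i ∈ F, Ex (hslice n k) (fun x => g x * uc α x i) := by
  have h1 : ∀ l' ∈ Fᶜ, Ex (hslice n k) (fun x => g x * uc α x l')
      = Ex (hslice n k) (fun x => g x * uc α x l) := by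
    intro l' hl'
    rw [Finset.mem_compl] at hl'
    rw [← Ex_swap (Equiv.swap l l') (fun x => g x * uc α x l)]
    refine Ex_congr fun x _ => ?_
    have e1 : g (x ∘ Equiv.swap l l') = g x := hg _ _ fun i hi => by
      have a : i ≠ l := fun h => hl (h ▸ hi)
      have b : i ≠ l' := fun h => hl' (h ▸ hi)
      simp [Equiv.swap_apply_of_ne_of_ne a b]
    rw [e1]
    simp [uc]
  have h2 : ∑ i, Ex (hslice n k) (fun x => g x * uc α x i) = 0 := by
    rw [← Ex_sum]
    have : Ex (hslice n k) (fun x => ∑ i, g x * uc α x i) = Ex (hslice n k) (fun x => 0 * 0) := by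
      refine Ex_congr fun x hx => ?_
      rw [← Finset.mul_sum, sum_uc hk hx]; ring
    rw [this, Ex_mul, zero_mul]
  rw [← Finset.sum_add_sum_compl F, Finset.sum_congr rfl h1, Finset.sum_const, nsmul_eq_mul,
    Finset.card_compl, Fintype.card_fin, Nat.cast_sub (by simpa using Finset.card_le_univ F)] at h2
  linarith

lemma abs_Ex_mul_uc {n k : ℕ} {α : ℝ} (hk : (k : ℝ) = α * n) (F : Finset (Fin n)) (B : ℝ)
    (g : (Fin n → Bool) → ℝ)
    (hg : ∀ x x' : Fin n → Bool, (∀ i ∈ F, x i = x' i) → g x = g x')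
    {l : Fin n} (hl : l ∉ F) (hF : (F.card : ℝ) < n)
    (hB : ∀ i ∈ F, |Ex (hslice n k) (fun x => g x * uc α x i)| ≤ B) :
    |Ex (hslice n k) (fun x => g x * uc α x l)| ≤ F.card * B / ((n : ℝ) - F.card) := by
  have h := Ex_mul_uc hk F g hg hl
  have hp : (0 : ℝ) < (n : ℝ) - F.card := by linarith
  rw [le_div_iff₀ hp, mul_comm]
  nth_rewrite 1 [← abs_of_pos hp]
  rw [← abs_mul, h, abs_neg]
  refine (Finset.abs_sum_le_sum_abs _ _).trans ?_
  refine (Finset.sum_le_sum hB).trans ?_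
  rw [Finset.sum_const, nsmul_eq_mul]

section Moments

variable {n k : ℕ} {α : ℝ}

lemma hslice_nonempty (h1 : α < 1) (hk : (k : ℝ) = α * n) : (hslice n k).Nonempty := by
  rw [← Finset.card_pos, card_slice_s18]
  apply Nat.choose_pos
  have : (k : ℝ) ≤ n := by
    rw [hk]; nlinarith [Nat.cast_nonneg (α := ℝ) n]
  exact_mod_cast this

lemma abs_mul_le_one' {a b : ℝ} (ha : |a| ≤ 1) (hb : |b| ≤ 1) : |a * b| ≤ 1 := by
  rw [abs_mul]; exact mul_le_one₀ ha (abs_nonneg _) hb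

lemma mom2 (h0 : 0 < α) (h1 : α < 1) (hk : (k : ℝ) = α * n) (hn : 2 ≤ n) {j l : Fin n} (hjl : j ≠ l) :
    |Ex (hslice n k) (fun x => uc α x j * uc α x l)| ≤ 2 / n := by
  have hn' : (2 : ℝ) ≤ n := by exact_mod_cast hn
  have := abs_Ex_mul_uc hk {j} 1 (fun x => uc α x j) (fun x x' h => by simp [uc, h])
    (l := l) (by simpa using hjl.symm) (by simp; linarith)
    (fun i _ => abs_Ex_le (hslice_nonempty h1 hk)
      fun x _ => abs_mul_le_one' (abs_uc_le h0 h1 _ _) (abs_uc_le h0 h1 _ _))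
  refine this.trans ?_
  simp only [Finset.card_singleton, Nat.cast_one]
  rw [div_le_div_iff₀ (by linarith) (by linarith)]
  linarith

lemma mom3 (h0 : 0 < α) (h1 : α < 1) (hk : (k : ℝ) = α * n) (hn : 6 ≤ n) {i j o l : Fin n}
    (hij : i ≠ j) (ho : o = i ∨ o = j) (hli : l ≠ i) (hlj : l ≠ j) :
    |Ex (hslice n k) (fun x => uc α x i * uc α x j * uc α x o * uc α x l)| ≤ 4 / n := by
  have hn' : (6 : ℝ) ≤ n := by exact_mod_cast hn
  have hc : ({i, j} : Finset (Fin n)).card = 2 := Finset.card_pair hij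
  have := abs_Ex_mul_uc hk {i, j} 1 (fun x => uc α x i * uc α x j * uc α x o)
    (fun x x' h => by
      have a := h i (by simp)
      have b := h j (by simp)
      rcases ho with rfl | rfl <;> simp [uc, a, b])
    (l := l) (by simp [hli, hlj]) (by rw [hc]; push_cast; linarith)
    (fun o' _ => abs_Ex_le (hslice_nonempty h1 hk)
      fun x _ => abs_mul_le_one' (abs_mul_le_one' (abs_mul_le_one' (abs_uc_le h0 h1 _ _)
        (abs_uc_le h0 h1 _ _)) (abs_uc_le h0 h1 _ _)) (abs_uc_le h0 h1 _ _))
  refine this.trans ?_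
  rw [hc]
  push_cast
  rw [div_le_div_iff₀ (by linarith) (by linarith)]
  linarith

lemma mom4 (h0 : 0 < α) (h1 : α < 1) (hk : (k : ℝ) = α * n) (hn : 6 ≤ n) {i j o l : Fin n}
    (hij : i ≠ j) (hoi : o ≠ i) (hoj : o ≠ j) (hli : l ≠ i) (hlj : l ≠ j) (hlo : l ≠ o) :
    |Ex (hslice n k) (fun x => uc α x i * uc α x j * uc α x o * uc α x l)| ≤ 24 / n ^ 2 := by
  have hn' : (6 : ℝ) ≤ n := by exact_mod_cast hn
  have hc : ({i, j, o} : Finset (Fin n)).card = 3 :=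
    Finset.card_eq_three.2 ⟨i, j, o, hij, hoi.symm, hoj.symm, rfl⟩
  have := abs_Ex_mul_uc hk {i, j, o} (4 / n) (fun x => uc α x i * uc α x j * uc α x o)
    (fun x x' h => by
      have a := h i (by simp)
      have b := h j (by simp)
      have c := h o (by simp)
      simp [uc, a, b, c])
    (l := l) (by simp [hli, hlj, hlo]) (by rw [hc]; push_cast; linarith)
    (fun o' ho' => by
      simp only [Finset.mem_insert, Finset.mem_singleton] at ho'
      rcases ho' with h | h | h
      · subst h
        have := mom3 h0 h1 hk hn hij (Or.inl rfl : o' = o' ∨ o' = j) hoi hoj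
        rw [Ex_congr (h := fun x => uc α x o' * uc α x j * uc α x o' * uc α x o) (fun x _ => by ring)]
        exact this
      · subst h
        have := mom3 h0 h1 hk hn hij (Or.inr rfl : o' = i ∨ o' = o') hoi hoj
        rw [Ex_congr (h := fun x => uc α x i * uc α x o' * uc α x o' * uc α x o) (fun x _ => by ring)]
        exact this
      · subst h
        have := mom3 h0 h1 hk hn hoi.symm (Or.inr rfl : o' = i ∨ o' = o') hij.symm hoj.symm
        rw [Ex_congr (h := fun x => uc α x i * uc α x o' * uc α x o' * uc α x j) (fun x _ => by ring)]
        exact this)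
  refine this.trans ?_
  rw [hc]
  push_cast
  have hn0 : (0 : ℝ) < n := by linarith
  have : (3 : ℝ) * (4 / n) / (n - 3) = 12 / (n * (n - 3)) := by
    field_simp [show (n : ℝ) - 3 ≠ 0 by linarith]
    try ring
  rw [this, div_le_div_iff₀ (by nlinarith) (by positivity)]
  nlinarith

lemma lin_second (h0 : 0 < α) (h1 : α < 1) (hk : (k : ℝ) = α * n) (hn : 2 ≤ n) (b : Fin n → ℝ) :
    Ex (hslice n k) (fun x => (∑ j, b j * uc α x j) ^ 2) ≤ 3 * ∑ j, b j ^ 2 := by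
  have hn' : (2 : ℝ) ≤ n := by exact_mod_cast hn
  have e : Ex (hslice n k) (fun x => (∑ j, b j * uc α x j) ^ 2)
      = ∑ j, ∑ l, b j * b l * Ex (hslice n k) (fun x => uc α x j * uc α x l) := by
    rw [Ex_congr (h := fun x => ∑ j, ∑ l, b j * b l * (uc α x j * uc α x l))]
    · rw [Ex_sum]
      refine Finset.sum_congr rfl fun j _ => ?_
      rw [Ex_sum]
      exact Finset.sum_congr rfl fun l _ => Ex_mul _ _
    · intro x _
      rw [sq, Finset.sum_mul_sum]
      exact Finset.sum_congr rfl fun j _ => Finset.sum_congr rfl fun l _ => by ring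
  rw [e]
  have bd : ∀ j l, b j * b l * Ex (hslice n k) (fun x => uc α x j * uc α x l)
      ≤ (if j = l then b j ^ 2 else 0) + (b j ^ 2 + b l ^ 2) / n := by
    intro j l
    have hnn : 0 ≤ (b j ^ 2 + b l ^ 2) / n := by positivity
    by_cases h : j = l
    · subst h
      simp only [if_true]
      have := abs_Ex_le (S := hslice n k) (a := 1) (hslice_nonempty h1 hk)
        (g := fun x => uc α x j * uc α x j) fun x _ =>
        abs_mul_le_one' (abs_uc_le h0 h1 _ _) (abs_uc_le h0 h1 _ _)
      have := (abs_le.1 this).2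
      nlinarith [sq_nonneg (b j)]
    · simp only [h, if_false, zero_add]
      have := mom2 h0 h1 hk hn h
      calc _ ≤ |b j * b l * Ex (hslice n k) (fun x => uc α x j * uc α x l)| := le_abs_self _
        _ = |b j * b l| * |Ex (hslice n k) (fun x => uc α x j * uc α x l)| := abs_mul _ _
        _ ≤ ((b j ^ 2 + b l ^ 2) / 2) * (2 / n) := by
            gcongr
            rw [abs_mul, ← sq_abs (b j), ← sq_abs (b l)]
            nlinarith [sq_nonneg (|b j| - |b l|)]
        _ = _ := by field_simp
  refine (Finset.sum_le_sum fun j _ => Finset.sum_le_sum fun l _ => bd j l).trans ?_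
  simp only [Finset.sum_add_distrib, Finset.sum_ite_eq, Finset.mem_univ, if_true, add_div,
    Finset.sum_const, nsmul_eq_mul, Finset.card_univ, Fintype.card_fin, ← Finset.sum_div,
    ← Finset.mul_sum]
  have : (n : ℝ) ≠ 0 := by linarith
  apply le_of_eq
  field_simp
  ring

end Moments

/-- Pairs of a relation. -/
def prs {n : ℕ} (N : Fin n → Finset (Fin n)) : Finset (Fin n × Fin n) :=
  Finset.univ.filter fun p => p.2 ∈ N p.1

section Count

variable {n D : ℕ} {N : Fin n → Finset (Fin n)}

lemma cnt_fst (hD : ∀ j, (N j).card ≤ D) (F : Finset (Fin n)) :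
    ((prs N).filter fun q => q.1 ∈ F).card ≤ D * F.card := by
  refine Finset.card_le_mul_card_image_of_maps_to (f := Prod.fst)
    (fun a ha => (Finset.mem_filter.1 ha).2) D fun b _ => ?_
  refine le_trans (Finset.card_le_card_of_injOn Prod.snd (t := N b) ?_ ?_) (hD b)
  · intro q hq
    simp only [prs, Finset.coe_filter, Finset.mem_filter, Finset.mem_univ, true_and,
      Set.mem_ofPred_eq] at hq
    rw [← hq.2]; exact hq.1.1
  · intro q hq q' hq' h
    simp only [prs, Finset.coe_filter, Finset.mem_filter, Finset.mem_univ, true_and,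
      Set.mem_ofPred_eq] at hq hq'
    exact Prod.ext (hq.2.trans hq'.2.symm) h

lemma cnt_snd (hs : ∀ j l, l ∈ N j ↔ j ∈ N l) (hD : ∀ j, (N j).card ≤ D) (F : Finset (Fin n)) :
    ((prs N).filter fun q => q.2 ∈ F).card ≤ D * F.card := by
  refine Finset.card_le_mul_card_image_of_maps_to (f := Prod.snd)
    (fun a ha => (Finset.mem_filter.1 ha).2) D fun b _ => ?_
  refine le_trans (Finset.card_le_card_of_injOn Prod.fst (t := N b) ?_ ?_) (hD b)
  · intro q hq
    simp only [prs, Finset.coe_filter, Finset.mem_filter, Finset.mem_univ, true_and,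
      Set.mem_ofPred_eq] at hq
    have := (hs q.1 q.2).1 hq.1.1
    rw [← hq.2]; exact this
  · intro q hq q' hq' h
    simp only [prs, Finset.coe_filter, Finset.mem_filter, Finset.mem_univ, true_and,
      Set.mem_ofPred_eq] at hq hq'
    exact Prod.ext h (hq.2.trans hq'.2.symm)

lemma cnt_all (hD : ∀ j, (N j).card ≤ D) : (prs N).card ≤ D * n := by
  have := cnt_fst hD Finset.univ
  simpa using this

end Count

/-- Second moment of the off-diagonal quadratic form on the slice. -/
lemma quad_second {n k D : ℕ} {α : ℝ} (h0 : 0 < α) (h1 : α < 1) (hk : (k : ℝ) = α * n) (hn : 6 ≤ n)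
    (N : Fin n → Finset (Fin n)) (hs : ∀ j l, l ∈ N j ↔ j ∈ N l) (hD : ∀ j, (N j).card ≤ D)
    (hDn : D ≤ n) (hoff : ∀ j, j ∉ N j) :
    Ex (hslice n k) (fun x => (∑ p ∈ prs N, uc α x p.1 * uc α x p.2) ^ 2) ≤ 44 * (D * n) := by
  classical
  have hn' : (6 : ℝ) ≤ n := by exact_mod_cast hn
  have hn0 : (0 : ℝ) < n := by linarith
  have e : Ex (hslice n k) (fun x => (∑ p ∈ prs N, uc α x p.1 * uc α x p.2) ^ 2)
      = ∑ p ∈ prs N, ∑ q ∈ prs N,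
        Ex (hslice n k) (fun x => uc α x p.1 * uc α x p.2 * uc α x q.1 * uc α x q.2) := by
    rw [← Finset.sum_congr rfl fun p _ => Ex_sum (prs N) _, ← Ex_sum]
    refine Ex_congr fun x _ => ?_
    rw [sq, Finset.sum_mul_sum]
    exact Finset.sum_congr rfl fun j _ => Finset.sum_congr rfl fun l _ => by ring
  rw [e]
  have hne : ∀ p ∈ prs N, p.1 ≠ p.2 := by
    intro p hp h
    simp only [prs, Finset.mem_filter, Finset.mem_univ, true_and] at hp
    rw [← h] at hp
    exact hoff _ hp
  have inner : ∀ p ∈ prs N, ∑ q ∈ prs N,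
        Ex (hslice n k) (fun x => uc α x p.1 * uc α x p.2 * uc α x q.1 * uc α x q.2) ≤ 44 := by
    intro p hp
    set F : Finset (Fin n) := {p.1, p.2} with hF
    have hFc : F.card = 2 := Finset.card_pair (hne p hp)
    have memF : ∀ o, o ∈ F ↔ o = p.1 ∨ o = p.2 := by intro o; simp [hF]
    have bd : ∀ q ∈ prs N,
        Ex (hslice n k) (fun x => uc α x p.1 * uc α x p.2 * uc α x q.1 * uc α x q.2) ≤
        (if q ∈ F ×ˢ F then (1 : ℝ) else 0) + (if q.1 ∈ F then 4 / (n : ℝ) else 0)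
          + (if q.2 ∈ F then 4 / (n : ℝ) else 0) + 24 / (n : ℝ) ^ 2 := by
      intro q hq
      refine (le_abs_self _).trans ?_
      have p4 : (0 : ℝ) ≤ 4 / n := by positivity
      have p24 : (0 : ℝ) ≤ 24 / (n : ℝ) ^ 2 := by positivity
      have pne := hne p hp
      have qne := hne q hq
      by_cases ha : q.1 ∈ F <;> by_cases hb : q.2 ∈ F
      · simp only [Finset.mem_product, ha, hb, and_self, if_true]
        have := abs_Ex_le (S := hslice n k) (a := 1) (hslice_nonempty h1 hk)
          (g := fun x => uc α x p.1 * uc α x p.2 * uc α x q.1 * uc α x q.2) fun x _ =>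
          abs_mul_le_one' (abs_mul_le_one' (abs_mul_le_one' (abs_uc_le h0 h1 _ _)
          (abs_uc_le h0 h1 _ _)) (abs_uc_le h0 h1 _ _)) (abs_uc_le h0 h1 _ _)
        linarith
      · simp only [Finset.mem_product, ha, hb, and_false, if_true, if_false]
        rw [memF] at ha hb
        push Not at hb
        have := mom3 h0 h1 hk hn pne ha hb.1 hb.2
        linarith
      · simp only [Finset.mem_product, ha, hb, false_and, if_true, if_false]
        rw [memF] at ha hb
        push Not at ha
        have := mom3 h0 h1 hk hn pne hb ha.1 ha.2
        rw [Ex_congr (h := fun x => uc α x p.1 * uc α x p.2 * uc α x q.2 * uc α x q.1)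
          (fun x _ => by ring)]
        linarith
      · simp only [Finset.mem_product, ha, hb, and_false, if_false]
        rw [memF] at ha hb
        push Not at ha hb
        have := mom4 h0 h1 hk hn pne ha.1 ha.2 hb.1 hb.2 qne.symm
        linarith
    refine (Finset.sum_le_sum bd).trans ?_
    rw [Finset.sum_add_distrib, Finset.sum_add_distrib, Finset.sum_add_distrib,
      ← Finset.sum_filter, ← Finset.sum_filter, ← Finset.sum_filter]
    simp only [Finset.sum_const, nsmul_eq_mul]
    have c1 : (((prs N).filter fun q => q ∈ F ×ˢ F).card : ℝ) ≤ 4 := by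
      have : ((prs N).filter fun q => q ∈ F ×ˢ F).card ≤ (F ×ˢ F).card :=
        Finset.card_le_card fun q hq => (Finset.mem_filter.1 hq).2
      rw [Finset.card_product, hFc] at this
      exact_mod_cast this
    have c2 : (((prs N).filter fun q => q.1 ∈ F).card : ℝ) ≤ n * 2 := by
      have := cnt_fst hD F
      rw [hFc] at this
      have h2 : ((prs N).filter fun q => q.1 ∈ F).card ≤ n * 2 := by omega
      exact_mod_cast h2
    have c3 : (((prs N).filter fun q => q.2 ∈ F).card : ℝ) ≤ n * 2 := by
      have := cnt_snd hs hD F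
      rw [hFc] at this
      have h2 : ((prs N).filter fun q => q.2 ∈ F).card ≤ n * 2 := by omega
      exact_mod_cast h2
    have c4 : ((prs N).card : ℝ) ≤ n * n := by
      have h2 : (prs N).card ≤ n * n := (cnt_all hD).trans (Nat.mul_le_mul_right _ hDn)
      exact_mod_cast h2
    calc _ ≤ 4 * 1 + (n * 2) * (4 / (n : ℝ)) + (n * 2) * (4 / (n : ℝ)) + (n * n) * (24 / (n : ℝ) ^ 2) := by
          gcongr
      _ = 44 := by field_simp; norm_num
  refine (Finset.sum_le_sum inner).trans ?_
  rw [Finset.sum_const, nsmul_eq_mul]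
  have : ((prs N).card : ℝ) ≤ D * n := by exact_mod_cast cnt_all hD
  linarith

lemma prs_sum {n : ℕ} (N : Fin n → Finset (Fin n)) (g : Fin n → Fin n → ℝ) :
    ∑ p ∈ prs N, g p.1 p.2 = ∑ j, ∑ l ∈ N j, g j l := by
  unfold prs
  rw [Finset.sum_filter, Fintype.sum_prod_type]
  refine Finset.sum_congr rfl fun j _ => ?_
  rw [← Finset.sum_filter]
  refine Finset.sum_congr ?_ fun _ _ => rfl
  ext l; simp

lemma nb_comm {n : ℕ} {N : Fin n → Finset (Fin n)} (hs : ∀ j l, l ∈ N j ↔ j ∈ N l)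
    (g : Fin n → Fin n → ℝ) : ∑ j, ∑ l ∈ N j, g j l = ∑ j, ∑ l ∈ N j, g l j := by
  refine Finset.sum_comm' fun x y => ?_
  simp [hs x y]

lemma nb_sum_fst {n D : ℕ} {N : Fin n → Finset (Fin n)} (hD : ∀ j, (N j).card ≤ D)
    (w : Fin n → ℝ) (hw : ∀ j, 0 ≤ w j) : ∑ j, ∑ _l ∈ N j, w j ≤ D * ∑ j, w j := by
  rw [Finset.mul_sum]
  refine Finset.sum_le_sum fun j _ => ?_
  rw [Finset.sum_const, nsmul_eq_mul]
  exact mul_le_mul_of_nonneg_right (by exact_mod_cast hD j) (hw j)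

lemma nb_sum_snd {n D : ℕ} {N : Fin n → Finset (Fin n)} (hs : ∀ j l, l ∈ N j ↔ j ∈ N l)
    (hD : ∀ j, (N j).card ≤ D)
    (w : Fin n → ℝ) (hw : ∀ j, 0 ≤ w j) : ∑ j, ∑ l ∈ N j, w l ≤ D * ∑ j, w j := by
  rw [nb_comm hs fun _ l => w l]
  exact nb_sum_fst hD w hw

/-- `a^T N a` bound -/
lemma nb_quad {n D : ℕ} {N : Fin n → Finset (Fin n)} (hs : ∀ j l, l ∈ N j ↔ j ∈ N l)
    (hD : ∀ j, (N j).card ≤ D) (a : Fin n → ℝ) :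
    ∑ j, ∑ l ∈ N j, |a j| * |a l| ≤ D * ∑ j, a j ^ 2 := by
  have h1 := nb_sum_fst hD (fun j => a j ^ 2) (fun j => sq_nonneg _)
  have h2 := nb_sum_snd hs hD (fun j => a j ^ 2) (fun j => sq_nonneg _)
  have h3 : ∑ j, ∑ l ∈ N j, |a j| * |a l| ≤ ∑ j, ∑ l ∈ N j, (a j ^ 2 + a l ^ 2) / 2 := by
    refine Finset.sum_le_sum fun j _ => Finset.sum_le_sum fun l _ => ?_
    rw [← sq_abs (a j), ← sq_abs (a l)]
    nlinarith [sq_nonneg (|a j| - |a l|)]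
  simp only [add_div, Finset.sum_add_distrib, ← Finset.sum_div] at h3
  linarith

lemma nb_vec {n D : ℕ} {N : Fin n → Finset (Fin n)} (hs : ∀ j l, l ∈ N j ↔ j ∈ N l)
    (hD : ∀ j, (N j).card ≤ D) (a : Fin n → ℝ) :
    ∑ j, (∑ l ∈ N j, a l) ^ 2 ≤ D * (D * ∑ j, a j ^ 2) := by
  have h2 := nb_sum_snd hs hD (fun j => a j ^ 2) (fun j => sq_nonneg _)
  refine le_trans ?_ (mul_le_mul_of_nonneg_left h2 (Nat.cast_nonneg _))
  rw [Finset.mul_sum]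
  refine Finset.sum_le_sum fun j _ => ?_
  refine sq_sum_le_card_mul_sum_sq.trans ?_
  exact mul_le_mul_of_nonneg_right (by exact_mod_cast hD j) (Finset.sum_nonneg fun _ _ => sq_nonneg _)

/-- mean of output j -/
noncomputable def pm {m n : ℕ} (f : (Fin m → Bool) → (Fin n → Bool)) (j : Fin n) : ℝ :=
  Ex Finset.univ (fun y => rv (f y j))

/-- centered output -/
noncomputable def zc {m n : ℕ} (f : (Fin m → Bool) → (Fin n → Bool)) (j : Fin n)
    (y : Fin m → Bool) : ℝ := rv (f y j) - pm f j

section XSide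

variable {m n : ℕ} (f : (Fin m → Bool) → (Fin n → Bool))

lemma Ex_zc (j : Fin n) : Ex Finset.univ (zc f j) = 0 := by
  have : Ex Finset.univ (zc f j) = Ex Finset.univ (fun y => rv (f y j) - pm f j) := rfl
  rw [this, Ex_sub, Ex_const Finset.univ_nonempty, pm, sub_self]

lemma abs_zc (j : Fin n) (y : Fin m → Bool) : |zc f j y| ≤ 1 := by
  have h0 : 0 ≤ pm f j := by
    rw [← Ex_const (S := (Finset.univ : Finset (Fin m → Bool))) Finset.univ_nonempty 0]
    exact Ex_mono fun y _ => by unfold rv; split_ifs <;> norm_num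
  have h1 : pm f j ≤ 1 := by
    rw [← Ex_const (S := (Finset.univ : Finset (Fin m → Bool))) Finset.univ_nonempty 1]
    exact Ex_mono fun y _ => by unfold rv; split_ifs <;> norm_num
  unfold zc rv
  rw [abs_le]
  split_ifs <;> constructor <;> linarith

lemma dep_zc (j : Fin n) : DepOn (inputsOf f j) (zc f j) := by
  intro y y' h
  have := depOn_output f j y y' h
  simp only at this
  simp [zc, this]

lemma cov_zero {j l : Fin n} (h : l ∉ Nb f j) :
    Ex Finset.univ (fun y => zc f j y * zc f l y) = 0 := by
  rw [indep_prod_s18 (disj_of_not_Nb f h) _ _ (dep_zc f j) (dep_zc f l), Ex_zc, zero_mul]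

lemma lin_X {D : ℕ} (hD : ∀ j, (Nb f j).card ≤ D) (a : Fin n → ℝ) :
    Ex Finset.univ (fun y => (∑ j, a j * zc f j y) ^ 2) ≤ D * ∑ j, a j ^ 2 := by
  have e : Ex Finset.univ (fun y => (∑ j, a j * zc f j y) ^ 2)
      = ∑ j, ∑ l, a j * a l * Ex Finset.univ (fun y => zc f j y * zc f l y) := by
    rw [Ex_congr (h := fun y => ∑ j, ∑ l, a j * a l * (zc f j y * zc f l y))]
    · rw [Ex_sum]
      refine Finset.sum_congr rfl fun j _ => ?_
      rw [Ex_sum]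
      exact Finset.sum_congr rfl fun l _ => Ex_mul _ _
    · intro x _
      rw [sq, Finset.sum_mul_sum]
      exact Finset.sum_congr rfl fun j _ => Finset.sum_congr rfl fun l _ => by ring
  rw [e]
  refine le_trans ?_ (nb_quad (fun j l => Nb_symm f) hD a)
  refine Finset.sum_le_sum fun j _ => ?_
  rw [← Finset.sum_subset (Finset.subset_univ (Nb f j)) fun l _ hl => by rw [cov_zero f hl, mul_zero]]
  refine Finset.sum_le_sum fun l _ => ?_
  refine (le_abs_self _).trans ?_
  rw [abs_mul, abs_mul]
  refine mul_le_of_le_one_right (by positivity) ?_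
  exact abs_Ex_le Finset.univ_nonempty fun y _ => abs_mul_le_one' (abs_zc f _ _) (abs_zc f _ _)

lemma quad_mean {k : ℕ} (hw : ∀ y, wt (f y) = k) :
    ∑ p ∈ prs (Nb f), Ex Finset.univ (fun y => zc f p.1 y * zc f p.2 y) = 0 := by
  rw [prs_sum (Nb f) fun j l => Ex Finset.univ (fun y => zc f j y * zc f l y)]
  refine Finset.sum_eq_zero fun j _ => ?_
  rw [Finset.sum_subset (Finset.subset_univ (Nb f j)) fun l _ hl => cov_zero f hl, ← Ex_sum]
  rw [Ex_congr (h := fun y => ((k : ℝ) - ∑ l, pm f l) * zc f j y)]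
  · rw [Ex_mul, Ex_zc, mul_zero]
  · intro y _
    rw [← Finset.mul_sum, mul_comm]
    congr 1
    unfold zc
    rw [Finset.sum_sub_distrib, ← wt_eq_sum, hw]

lemma quad_X {D k : ℕ} (hw : ∀ y, wt (f y) = k) (hD : ∀ j, (Nb f j).card ≤ D) :
    Ex Finset.univ (fun y => (∑ p ∈ prs (Nb f), zc f p.1 y * zc f p.2 y) ^ 2)
      ≤ 8 * ((D : ℝ) ^ 3 * n) := by
  classical
  set Z : Fin n × Fin n → (Fin m → Bool) → ℝ := fun p y => zc f p.1 y * zc f p.2 y with hZ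
  have hZ1 : ∀ p y, |Z p y| ≤ 1 := fun p y => abs_mul_le_one' (abs_zc f _ _) (abs_zc f _ _)
  have hZdep : ∀ p, DepOn (inputsOf f p.1 ∪ inputsOf f p.2) (Z p) := by
    intro p y y' h
    simp only [hZ]
    rw [dep_zc f p.1 y y' fun i hi => h i (Finset.mem_union_left _ hi),
      dep_zc f p.2 y y' fun i hi => h i (Finset.mem_union_right _ hi)]
  have e : Ex Finset.univ (fun y => (∑ p ∈ prs (Nb f), Z p y) ^ 2)
      = ∑ p ∈ prs (Nb f), ∑ q ∈ prs (Nb f),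
        (Ex Finset.univ (fun y => Z p y * Z q y) - Ex Finset.univ (Z p) * Ex Finset.univ (Z q)) := by
    simp only [Finset.sum_sub_distrib]
    rw [← Finset.sum_mul_sum]
    have h0 : ∑ p ∈ prs (Nb f), Ex Finset.univ (Z p) = 0 := quad_mean f hw
    rw [h0, mul_zero, sub_zero]
    rw [← Finset.sum_congr rfl fun p _ => Ex_sum (prs (Nb f)) _, ← Ex_sum]
    refine Ex_congr fun x _ => ?_
    rw [sq, Finset.sum_mul_sum]
  rw [e]
  have inner : ∀ p ∈ prs (Nb f), ∑ q ∈ prs (Nb f),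
      (Ex Finset.univ (fun y => Z p y * Z q y) - Ex Finset.univ (Z p) * Ex Finset.univ (Z q))
        ≤ 8 * (D : ℝ) ^ 2 := by
    intro p _
    set F := Nb f p.1 ∪ Nb f p.2 with hF
    have hFc : F.card ≤ 2 * D := by
      have := Finset.card_union_le (Nb f p.1) (Nb f p.2)
      have a := hD p.1
      have b := hD p.2
      rw [← hF] at this
      omega
    have bd : ∀ q ∈ prs (Nb f),
        (Ex Finset.univ (fun y => Z p y * Z q y) - Ex Finset.univ (Z p) * Ex Finset.univ (Z q))
        ≤ (if q.1 ∈ F then (2 : ℝ) else 0) + (if q.2 ∈ F then (2 : ℝ) else 0) := by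
      intro q _
      have hle : (Ex Finset.univ (fun y => Z p y * Z q y)
          - Ex Finset.univ (Z p) * Ex Finset.univ (Z q)) ≤ 2 := by
        have a1 := abs_Ex_le (S := (Finset.univ : Finset (Fin m → Bool))) (a := 1)
          Finset.univ_nonempty (g := fun y => Z p y * Z q y)
          fun y _ => abs_mul_le_one' (hZ1 _ _) (hZ1 _ _)
        have a2 := abs_mul_le_one'
          (abs_Ex_le (S := (Finset.univ : Finset (Fin m → Bool))) (a := 1)
            Finset.univ_nonempty (g := Z p) fun y _ => hZ1 _ _)
          (abs_Ex_le (S := (Finset.univ : Finset (Fin m → Bool))) (a := 1)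
            Finset.univ_nonempty (g := Z q) fun y _ => hZ1 _ _)
        have b1 := (abs_le.1 a1).2
        have b2 := (abs_le.1 a2).1
        linarith
      by_cases ha : q.1 ∈ F
      · simp only [ha, if_true]
        split_ifs <;> linarith
      by_cases hb : q.2 ∈ F
      · simp only [ha, hb, if_true, if_false]; linarith
      simp only [ha, hb, if_false]
      rw [hF, Finset.mem_union, not_or] at ha hb
      rw [indep_prod_s18 ?_ _ _ (hZdep p) (hZdep q)]
      · linarith
      · rw [Finset.disjoint_union_left, Finset.disjoint_union_right, Finset.disjoint_union_right]
        exact ⟨⟨disj_of_not_Nb f ha.1, disj_of_not_Nb f hb.1⟩,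
          ⟨disj_of_not_Nb f ha.2, disj_of_not_Nb f hb.2⟩⟩
    refine (Finset.sum_le_sum bd).trans ?_
    rw [Finset.sum_add_distrib, ← Finset.sum_filter, ← Finset.sum_filter]
    simp only [Finset.sum_const, nsmul_eq_mul]
    have c2 : (((prs (Nb f)).filter fun q => q.1 ∈ F).card : ℝ) ≤ D * (2 * D) := by
      exact_mod_cast (cnt_fst hD F).trans (Nat.mul_le_mul_left _ hFc)
    have c3 : (((prs (Nb f)).filter fun q => q.2 ∈ F).card : ℝ) ≤ D * (2 * D) := by
      exact_mod_cast (cnt_snd (fun j l => Nb_symm f) hD F).trans (Nat.mul_le_mul_left _ hFc)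
    nlinarith
  refine (Finset.sum_le_sum inner).trans ?_
  rw [Finset.sum_const, nsmul_eq_mul]
  have : ((prs (Nb f)).card : ℝ) ≤ D * n := by exact_mod_cast cnt_all hD
  calc _ ≤ (D * n : ℝ) * (8 * (D : ℝ) ^ 2) := by gcongr
    _ = _ := by ring

end XSide

lemma quad_U_expand {n k : ℕ} {α : ℝ} (hk : (k : ℝ) = α * n)
    (N : Fin n → Finset (Fin n)) (hs : ∀ j l, l ∈ N j ↔ j ∈ N l) (hself : ∀ j, j ∈ N j)
    (a : Fin n → ℝ) {x : Fin n → Bool} (hx : x ∈ hslice n k) :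
    ∑ p ∈ prs N, (uc α x p.1 + a p.1) * (uc α x p.2 + a p.2)
      = (n * (α * (1 - α)) + ∑ j, ∑ l ∈ N j, a j * a l)
        + (∑ p ∈ prs (fun j => (N j).erase j), uc α x p.1 * uc α x p.2
          + 2 * ∑ j, (∑ l ∈ N j, a l) * uc α x j) := by
  rw [prs_sum N fun j l => (uc α x j + a j) * (uc α x l + a l),
    prs_sum (fun j => (N j).erase j) fun j l => uc α x j * uc α x l, ← sum_uc_sq hk hx]
  have e1 : ∀ j, ∑ l ∈ N j, (uc α x j + a j) * (uc α x l + a l)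
      = ∑ l ∈ N j, uc α x j * uc α x l + ∑ l ∈ N j, a j * a l
        + (∑ l ∈ N j, uc α x j * a l + ∑ l ∈ N j, a j * uc α x l) := by
    intro j
    rw [← Finset.sum_add_distrib, ← Finset.sum_add_distrib, ← Finset.sum_add_distrib]
    exact Finset.sum_congr rfl fun l _ => by ring
  simp only [e1, Finset.sum_add_distrib]
  have e2 : ∑ j, ∑ l ∈ N j, a j * uc α x l = ∑ j, ∑ l ∈ N j, uc α x j * a l := by
    rw [nb_comm hs]
    exact Finset.sum_congr rfl fun j _ => Finset.sum_congr rfl fun l _ => by ring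
  have e3 : ∑ j, (∑ l ∈ N j, a l) * uc α x j = ∑ j, ∑ l ∈ N j, uc α x j * a l := by
    refine Finset.sum_congr rfl fun j _ => ?_
    rw [Finset.sum_mul]
    exact Finset.sum_congr rfl fun l _ => by ring
  have e4 : ∑ j, ∑ l ∈ N j, uc α x j * uc α x l
      = ∑ j, uc α x j * uc α x j + ∑ j, ∑ l ∈ (N j).erase j, uc α x j * uc α x l := by
    rw [← Finset.sum_add_distrib]
    refine Finset.sum_congr rfl fun j _ => ?_
    exact (Finset.add_sum_erase _ (fun l => uc α x j * uc α x l) (hself j)).symm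
  rw [e2, e3, e4]
  ring

set_option maxHeartbeats 1000000 in
lemma core {α : ℝ} (h0 : 0 < α) (h1 : α < 1) {ε : ℝ} (hε : 0 < ε) {n k m D : ℕ}
    (hk : (k : ℝ) = α * n) (hD1 : 1 ≤ D)
    (hn6 : 6 * (D : ℝ) ^ 3 ≤ n)
    (hnA : 48 / (ε * (α * (1 - α))) * (D : ℝ) ^ 3 ≤ n)
    (hnB : 256 / (ε * (α * (1 - α)) ^ 2) * (D : ℝ) ^ 3 ≤ n)
    (hnC : 32 * (88 + 576 / ε) / (ε * (α * (1 - α)) ^ 2) * (D : ℝ) ^ 3 ≤ n)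
    (f : (Fin m → Bool) → (Fin n → Bool)) (hw : ∀ y, wt (f y) = k)
    (hD : ∀ j, (Nb f j).card ≤ D) :
    1 - ε ≤ SD (srcDist f) (uniformSlice n k) := by
  classical
  have hD1' : (1 : ℝ) ≤ D := by exact_mod_cast hD1
  have hD3 : (D : ℝ) ≤ (D : ℝ) ^ 3 := le_self_pow₀ hD1' (by norm_num)
  have hD32 : (D : ℝ) ^ 2 ≤ (D : ℝ) ^ 3 := pow_le_pow_right₀ hD1' (by norm_num)
  have hn6' : (6 : ℝ) ≤ n := by nlinarith
  have hn : 6 ≤ n := by exact_mod_cast hn6'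
  have hDn' : (D : ℝ) ≤ n := by nlinarith
  have hDn : D ≤ n := by exact_mod_cast hDn'
  have hD3n : (D : ℝ) ^ 3 ≤ n := by nlinarith
  set v := α * (1 - α) with hv
  have hv0 : 0 < v := mul_pos h0 (by linarith)
  have hkn : k ≤ n := by
    have : (k : ℝ) ≤ n := by rw [hk]; nlinarith
    exact_mod_cast this
  set a : Fin n → ℝ := fun j => α - pm f j with ha
  set W := ∑ j, a j ^ 2 with hW
  have hW0 : 0 ≤ W := Finset.sum_nonneg fun _ _ => sq_nonneg _
  have hrv : ∀ (x : Fin n → Bool) j, rv (x j) - pm f j = uc α x j + a j := by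
    intro x j; simp [uc, ha]
  rcases le_total (24 / ε * D) W with hcase | hcase
  · -- linear test
    have hWpos : 0 < W := lt_of_lt_of_le (by positivity) hcase
    have h24 : 24 * D ≤ ε * W := by
      rw [div_mul_eq_mul_div, div_le_iff₀ hε] at hcase
      linarith
    refine sd_of_test hkn f ε (W / 2) (by positivity) (fun x => ∑ j, a j * (rv (x j) - pm f j)) ?_ ?_
    · refine (lin_X f hD a).trans ?_
      rw [← hW]
      nlinarith
    · have := lin_second h0 h1 hk (by omega : 2 ≤ n) a
      rw [Ex_congr (h := fun x => (∑ j, a j * uc α x j) ^ 2)]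
      · refine this.trans ?_
        rw [← hW]
        nlinarith
      · intro x _
        congr 1
        simp only [hrv, mul_add, Finset.sum_add_distrib]
        have : ∑ j, a j * a j = W := Finset.sum_congr rfl fun j _ => by ring
        rw [this]; ring
  · -- quadratic test
    have hs : ∀ j l, l ∈ Nb f j ↔ j ∈ Nb f l := fun j l => Nb_symm f
    set q0 := ∑ j, ∑ l ∈ Nb f j, a j * a l with hq0
    have hq : -(D * W) ≤ q0 := by
      have := nb_quad hs hD a
      have h2 : -(∑ j, ∑ l ∈ Nb f j, |a j| * |a l|) ≤ q0 := by
        rw [← Finset.sum_neg_distrib]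
        refine Finset.sum_le_sum fun j _ => ?_
        rw [← Finset.sum_neg_distrib]
        refine Finset.sum_le_sum fun l _ => ?_
        rw [← abs_mul]
        exact neg_abs_le _
      linarith
    have hDW : D * W ≤ 24 / ε * (D : ℝ) ^ 2 := by
      have := mul_le_mul_of_nonneg_left hcase (Nat.cast_nonneg (α := ℝ) D)
      refine this.trans (le_of_eq ?_)
      ring
    have hA : 24 / ε * (D : ℝ) ^ 3 ≤ n * v / 2 := by
      have : 48 / (ε * v) * (D : ℝ) ^ 3 * (v / 2) ≤ n * (v / 2) :=
        mul_le_mul_of_nonneg_right hnA (by positivity)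
      have e : 48 / (ε * v) * (D : ℝ) ^ 3 * (v / 2) = 24 / ε * (D : ℝ) ^ 3 := by
        field_simp; norm_num
      linarith
    have hA2 : 24 / ε * (D : ℝ) ^ 2 ≤ 24 / ε * (D : ℝ) ^ 3 := by gcongr
    set t := (n * v + q0) / 2 with ht
    have ht4 : n * v / 4 ≤ t := by rw [ht]; linarith
    have hnv : 0 < n * v / 4 := by positivity
    have ht0 : 0 < t := by linarith
    have ht2 : ε / 2 * (n * v / 4) ^ 2 ≤ ε / 2 * t ^ 2 := by gcongr
    refine sd_of_test hkn f ε t ht0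
      (fun x => ∑ p ∈ prs (Nb f), (rv (x p.1) - pm f p.1) * (rv (x p.2) - pm f p.2)) ?_ ?_
    · refine (quad_X f hw hD).trans (le_trans ?_ ht2)
      have : 256 / (ε * v ^ 2) * (D : ℝ) ^ 3 * (n * (ε * v ^ 2) / 32) ≤ n * (n * (ε * v ^ 2) / 32) :=
        mul_le_mul_of_nonneg_right hnB (by positivity)
      have e : 256 / (ε * v ^ 2) * (D : ℝ) ^ 3 * (n * (ε * v ^ 2) / 32) = 8 * ((D : ℝ) ^ 3 * n) := by
        field_simp; norm_num
      have e2 : ε / 2 * (n * v / 4) ^ 2 = n * (n * (ε * v ^ 2) / 32) := by ring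
      linarith
    · have b1 := quad_second (D := D) h0 h1 hk hn (fun j => (Nb f j).erase j)
        (fun j l => by
          simp only [Finset.mem_erase, ne_eq]
          rw [hs j l, eq_comm])
        (fun j => (Finset.card_le_card (Finset.erase_subset _ _)).trans (hD j)) hDn
        (fun j => Finset.notMem_erase _ _)
      have b2 := lin_second h0 h1 hk (by omega : 2 ≤ n) (fun j => ∑ l ∈ Nb f j, a l)
      have b3 := nb_vec hs hD a
      rw [← hW] at b3
      have b4 : Ex (hslice n k) (fun x => (∑ p ∈ prs (Nb f), (rv (x p.1) - pm f p.1) * (rv (x p.2) - pm f p.2)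
          - 2 * t) ^ 2) ≤ 2 * Ex (hslice n k) (fun x =>
            (∑ p ∈ prs (fun j => (Nb f j).erase j), uc α x p.1 * uc α x p.2) ^ 2)
          + 8 * Ex (hslice n k) (fun x => (∑ j, (∑ l ∈ Nb f j, a l) * uc α x j) ^ 2) := by
        rw [← Ex_mul, ← Ex_mul, ← Ex_add]
        refine Ex_mono fun x hx => ?_
        simp only [hrv]
        rw [quad_U_expand hk (Nb f) hs (Nb_self f) a hx, ← hq0, ht]
        generalize ∑ p ∈ prs (fun j => (Nb f j).erase j), uc α x p.1 * uc α x p.2 = A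
        generalize ∑ j, (∑ l ∈ Nb f j, a l) * uc α x j = B
        nlinarith [sq_nonneg (A - 2 * B)]
      refine b4.trans (le_trans ?_ ht2)
      have b5 : (D : ℝ) * (D * W) ≤ 24 / ε * (D : ℝ) ^ 3 := by
        have := mul_le_mul_of_nonneg_left hDW (Nat.cast_nonneg (α := ℝ) D)
        refine this.trans (le_of_eq ?_)
        ring
      have b6 : (D : ℝ) ^ 3 ≤ D * n := by
        have := mul_le_mul_of_nonneg_right hD1' (Nat.cast_nonneg (α := ℝ) n)
        linarith
      have b7 : 24 / ε * (D : ℝ) ^ 3 ≤ 24 / ε * (D * n) := by gcongr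
      have c1 : 32 * (88 + 576 / ε) / (ε * v ^ 2) * (D : ℝ) ^ 3 * (n * (ε * v ^ 2) / 32)
          ≤ n * (n * (ε * v ^ 2) / 32) :=
        mul_le_mul_of_nonneg_right hnC (by positivity)
      have c2 : 32 * (88 + 576 / ε) / (ε * v ^ 2) * (D : ℝ) ^ 3 * (n * (ε * v ^ 2) / 32)
          = (88 + 576 / ε) * ((D : ℝ) ^ 3 * n) := by
        field_simp
      have c3 : (88 + 576 / ε) * (D * n) ≤ (88 + 576 / ε) * ((D : ℝ) ^ 3 * n) := by gcongr
      have c4 : (88 + 576 / ε) * (D * n) = 88 * (D * n) + 24 * (24 / ε * (D * n)) := by ring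
      have e2 : ε / 2 * (n * v / 4) ^ 2 = n * (n * (ε * v ^ 2) / 32) := by ring
      linarith

lemma support_wt {m n k : ℕ} (f : (Fin m → Bool) → (Fin n → Bool))
    (h : ∀ x : Fin n → Bool, srcDist f x ≠ 0 → wt x = k) (y : Fin m → Bool) : wt (f y) = k := by
  apply h
  unfold srcDist
  have : 0 < (Finset.univ.filter fun y' => f y' = f y).card :=
    Finset.card_pos.2 ⟨y, by simp⟩
  have : (0 : ℝ) < ((Finset.univ.filter fun y' => f y' = f y).card : ℝ) := by exact_mod_cast this
  positivity

/-- A good degree bound. -/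
lemma exists_D {m n k c d : ℕ} (hc : 1 ≤ c) (hd : 1 ≤ d) (f : (Fin m → Bool) → (Fin n → Bool))
    (hf : hasDecisionDepth f d) (ho : ∀ i : Fin m, (outputsOf f i).card ≤ c)
    (hw : ∀ y, wt (f y) = k) :
    ∃ D : ℕ, 1 ≤ D ∧ (∀ j, (Nb f j).card ≤ D) ∧ D ^ 3 ≤ 8 * ((c * d) ^ 2 * 2 ^ (c * d)) := by
  have hpos : 1 ≤ (c * d) ^ 2 * 2 ^ (c * d) :=
    Nat.one_le_iff_ne_zero.2 (by positivity)
  rcases Nat.lt_or_ge c 3 with h3 | h3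
  · refine ⟨2, by norm_num, fun j => ?_, by omega⟩
    exact card_Nb_two f hw (fun i => (ho i).trans (by omega)) j
  · refine ⟨c * 2 ^ d, Nat.one_le_iff_ne_zero.2 (by positivity), card_Nb_gen hc f hf ho, ?_⟩
    obtain ⟨e, rfl⟩ : ∃ e, c = 3 + e := ⟨c - 3, by omega⟩
    have h1 : 3 + e ≤ 3 * 2 ^ (e * d) := by
      have a1 : e < 2 ^ e := Nat.lt_two_pow_self
      have a2 : 2 ^ e ≤ 2 ^ (e * d) := Nat.pow_le_pow_right (by norm_num) (Nat.le_mul_of_pos_right _ hd)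
      omega
    have h2 : (3 + e) ^ 2 ≤ ((3 + e) * d) ^ 2 := Nat.pow_le_pow_left (Nat.le_mul_of_pos_right _ hd) 2
    calc ((3 + e) * 2 ^ d) ^ 3 = (3 + e) ^ 2 * ((3 + e) * 2 ^ (3 * d)) := by
          rw [mul_comm 3 d, pow_mul]; ring
      _ ≤ ((3 + e) * d) ^ 2 * ((3 * 2 ^ (e * d)) * 2 ^ (3 * d)) := by gcongr
      _ = 3 * (((3 + e) * d) ^ 2 * 2 ^ ((3 + e) * d)) := by
          rw [add_mul 3 e d, pow_add]; ring
      _ ≤ _ := by omega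

/-- Let `α ∈ (0,1)`. For every `ε > 0` there is a constant `Mc` such
that whenever `αn` is an integer `k`, `c, d ≥ 1`, `n ≥ Mc (cd)² 2^{cd}`, and `X = f(Y)`
where `f` has decision depth `d`, each input bit of `f` affects at most `c` output bits,
and the support of `X` is contained in the weight-`αn` slice, then
`Δ(X, U_{αn}^n) ≥ 1 - ε`. -/
theorem stmt18 (α : ℝ) (hα : 0 < α) (hα1 : α < 1) :
    ∀ ε : ℝ, 0 < ε → ∃ Mc : ℝ, ∀ n k c d m : ℕ,
      (k : ℝ) = α * n → 1 ≤ c → 1 ≤ d →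
      Mc * ((c * d : ℕ) : ℝ) ^ 2 * 2 ^ (c * d) ≤ (n : ℝ) →
      ∀ f : (Fin m → Bool) → (Fin n → Bool),
        hasDecisionDepth f d →
        (∀ i : Fin m, (outputsOf f i).card ≤ c) →
        (∀ x : Fin n → Bool, srcDist f x ≠ 0 → wt x = k) →
        1 - ε ≤ SD (srcDist f) (uniformSlice n k) := by

  intro ε hε
  have hv0 : 0 < α * (1 - α) := mul_pos hα (by linarith)
  set A := 48 / (ε * (α * (1 - α))) with hA
  set B := 256 / (ε * (α * (1 - α)) ^ 2) with hB
  set C := 32 * (88 + 576 / ε) / (ε * (α * (1 - α)) ^ 2) with hC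
  have hA0 : 0 < A := by positivity
  have hB0 : 0 < B := by positivity
  have hC0 : 0 < C := by positivity
  refine ⟨8 * (6 + A + B + C), ?_⟩
  intro n k c d m hk hc hd hn f hf ho hsupp
  have hw := support_wt f hsupp
  obtain ⟨D, hD1, hD, hD3⟩ := exists_D hc hd f hf ho hw
  have hD3' : (D : ℝ) ^ 3 ≤ 8 * (((c * d : ℕ) : ℝ) ^ 2 * 2 ^ (c * d)) := by exact_mod_cast hD3
  have key : (6 + A + B + C) * (D : ℝ) ^ 3 ≤ n := by
    refine le_trans (mul_le_mul_of_nonneg_left hD3' (by positivity)) (le_trans (le_of_eq ?_) hn)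
    ring
  have hp : 0 ≤ (D : ℝ) ^ 3 := by positivity
  have kA := mul_nonneg hA0.le hp
  have kB := mul_nonneg hB0.le hp
  have kC := mul_nonneg hC0.le hp
  have key' : 6 * (D : ℝ) ^ 3 + A * (D : ℝ) ^ 3 + B * (D : ℝ) ^ 3 + C * (D : ℝ) ^ 3 ≤ n := by
    linarith
  exact core hα hα1 hε hk hD1 (by linarith) (by linarith) (by linarith) (by linarith) f hw hD
end
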